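/- arXiv:math/0211107 — 2 statements merged into one kernel-verified Lean document; each statement's English description precedes it below -/
import Mathlib

section
/- Let q ≥ 121 be an odd prime power and let E be an elliptic curve over F_q in canonical form Y² = X³ + aX² + bX + c with j(E) ≠ 0, and n = #E(F_q). If a point Q = (Q₁ : Q₂ : Q₃ : Q₄) of P³(F_q) \ φ₄(E(F_q)) can be added to the (n; 4, 2)-set φ₄(E(F_q)) (i.e., no hyperplane of P³(F_q) through Q meets φ₄(E(F_q)) in 4 points), then Q lies on the line through the fundamental points (0:0:1:0) and (0:0:0:1), i.e., Q₁ = Q₂ = 0. -/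
set_option linter.unusedSectionVars false

namespace NMDS

open WeierstrassCurve

variable {F : Type} [Field F] [Fintype F] [DecidableEq F]

/-- `ψ_i(X,Y)`: `Y^s` if `i = 3s` (`s ≥ 1`), `X·Y^s` if `i = 3s+2` (`s ≥ 0`),
`X²·Y^s` if `i = 3s+4` (`s ≥ 0`). -/
def psi (i : ℕ) (X Y : F) : F :=
  if i % 3 = 0 then Y ^ (i / 3)
  else if i % 3 = 2 then X * Y ^ (i / 3)
  else X ^ 2 * Y ^ ((i - 4) / 3)

/-- The coordinate vector of `φ_k(P)`: `(1, ψ₂(P), …, ψ_k(P))` for an affine point `P`,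
and `(0, …, 0, 1)` for the point at infinity. -/
def phiVec (W : WeierstrassCurve F) (k : ℕ) : W.toAffine.Point → (Fin k → F)
  | .zero => fun j => if (j : ℕ) = k - 1 then 1 else 0
  | .some (x := x) (y := y) _ => fun j => if (j : ℕ) = 0 then 1 else psi ((j : ℕ) + 1) x y

lemma phiVec_ne_zero (W : WeierstrassCurve F) {k : ℕ} (hk : 0 < k)
    (P : W.toAffine.Point) : phiVec W k P ≠ 0 := by
  cases P with
  | zero =>
    intro h
    have := congrFun h ⟨k - 1, by omega⟩
    simp [phiVec] at this
  | some h' =>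
    intro h
    have := congrFun h ⟨0, hk⟩
    simp [phiVec] at this

/-- The image of a rational point of `E` in `P^{k-1}(F_q)` under `φ_k`. -/
noncomputable def phiProj (W : WeierstrassCurve F) {k : ℕ} (hk : 0 < k)
    (P : W.toAffine.Point) : Projectivization F (Fin k → F) :=
  Projectivization.mk F (phiVec W k P) (phiVec_ne_zero W hk P)

/-- The `k`-elliptic code associated to `E`, relative to an enumeration `e` of the `n`
rational points of `E`: the span of the rows of the `k × n` matrix whose `j`-th column
is `φ_k(P_j)`. -/
def ellipticCode (W : WeierstrassCurve F) (k : ℕ) {n : ℕ}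
    (e : Fin n ≃ W.toAffine.Point) : Submodule F (Fin n → F) :=
  Submodule.span F (Set.range fun i : Fin k => fun j : Fin n => phiVec W k (e j) i)

/-- The minimum distance (= minimum weight) of a linear code. -/
noncomputable def minDist {n : ℕ} (C : Submodule F (Fin n → F)) : ℕ :=
  sInf {d | ∃ x ∈ C, x ≠ 0 ∧ hammingNorm x = d}

/-- The standard inner product with `y` as a linear map. -/
def dotLin {n : ℕ} (y : Fin n → F) : (Fin n → F) →ₗ[F] F where
  toFun x := ∑ i, x i * y i
  map_add' a b := by simp [add_mul, Finset.sum_add_distrib]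
  map_smul' c a := by simp [Finset.mul_sum, mul_assoc]

/-- The dual code: all vectors orthogonal to every codeword. -/
def dualCode {n : ℕ} (C : Submodule F (Fin n → F)) : Submodule F (Fin n → F) :=
  ⨅ y ∈ C, LinearMap.ker (dotLin y)

/-- The Singleton defect `s(C) = n - k + 1 - d` of a code of length `n`. -/
noncomputable def singletonDefect {n : ℕ} (C : Submodule F (Fin n → F)) : ℤ :=
  (n : ℤ) + 1 - Module.finrank F C - minDist C

/-- A code is MDS if its Singleton defect is zero. -/
noncomputable def IsMDS {n : ℕ} (C : Submodule F (Fin n → F)) : Prop :=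
  singletonDefect C = 0

/-- A code is near-MDS if both it and its dual have Singleton defect one. -/
noncomputable def IsNMDS {n : ℕ} (C : Submodule F (Fin n → F)) : Prop :=
  singletonDefect C = 1 ∧ singletonDefect (dualCode C) = 1

/-- An `[n,k,d]_q` code `C` is `h`-extendable if there is an `[n+h,k,d+h]_q` code `C'`
whose projection on the first `n` coordinates is `C`. -/
noncomputable def IsHExtendable {n : ℕ} (h : ℕ) (C : Submodule F (Fin n → F)) : Prop :=
  ∃ C' : Submodule F (Fin (n + h) → F),
    Module.finrank F C' = Module.finrank F C ∧
    minDist C' = minDist C + h ∧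
    Submodule.map (LinearMap.funLeft F F (Fin.castAdd h)) C' = C

/-- The point `p` of `P^{k-1}(F_q)` lies on the hyperplane with coefficient vector `a`. -/
def OnHyp {k : ℕ} (a : Fin k → F) (p : Projectivization F (Fin k → F)) : Prop :=
  ∑ i, a i * p.rep i = 0

/-- An `(·; k, k-2)`-set in `P^{k-1}(F_q)`: no `k+1` of its points lie on a common hyperplane,
i.e. every hyperplane contains at most `k` of its points. -/
def IsArcSet (k : ℕ) (S : Set (Projectivization F (Fin k → F))) : Prop :=
  ∀ a : Fin k → F, a ≠ 0 → Set.ncard {p ∈ S | OnHyp a p} ≤ k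

/-- A complete `(·; k, k-2)`-set: maximal with respect to set-theoretical inclusion. -/
def IsCompleteArcSet (k : ℕ) (S : Set (Projectivization F (Fin k → F))) : Prop :=
  IsArcSet k S ∧ ∀ T, IsArcSet k T → S ⊆ T → T = S

/-- Evaluation of the homogeneous cubic of a Weierstrass curve:
`Y²Z + a₁XYZ + a₃YZ² - X³ - a₂X²Z - a₄XZ² - a₆Z³`. -/
def cubicEval {R : Type*} [CommRing R] (W : WeierstrassCurve R) (x y z : R) : R :=
  y ^ 2 * z + W.a₁ * x * y * z + W.a₃ * y * z ^ 2
    - (x ^ 3 + W.a₂ * x ^ 2 * z + W.a₄ * x * z ^ 2 + W.a₆ * z ^ 3)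

/-- The gradient of the homogeneous cubic of a Weierstrass curve. -/
def gradEval {R : Type*} [CommRing R] (W : WeierstrassCurve R) (x y z : R) : Fin 3 → R :=
  ![W.a₁ * y * z - (3 * x ^ 2 + 2 * W.a₂ * x * z + W.a₄ * z ^ 2),
    2 * y * z + W.a₁ * x * z + W.a₃ * z ^ 2,
    y ^ 2 + W.a₁ * x * y + 2 * W.a₃ * y * z - (W.a₂ * x ^ 2 + 2 * W.a₄ * x * z + 3 * W.a₆ * z ^ 2)]

/-- The point `p` of `P²(F_q)` lies on the plane cubic `E`. -/
def OnCurve (W : WeierstrassCurve F) (p : Projectivization F (Fin 3 → F)) : Prop :=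
  cubicEval W (p.rep 0) (p.rep 1) (p.rep 2) = 0

/-- A line of `P²(F_q)`, given by its coefficient vector `l`, is a tangent of `E`:
it touches the curve at some point (over the algebraic closure) with multiplicity at
least two, i.e. it is the tangent line of the cubic at a contact point. -/
def IsTangentLine (W : WeierstrassCurve F) (l : Fin 3 → F) : Prop :=
  ∃ v : Fin 3 → AlgebraicClosure F, v ≠ 0 ∧
    cubicEval (W.baseChange (AlgebraicClosure F)) (v 0) (v 1) (v 2) = 0 ∧
    (∑ i, algebraMap F (AlgebraicClosure F) (l i) * v i) = 0 ∧
    ∃ t : AlgebraicClosure F, t ≠ 0 ∧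
      gradEval (W.baseChange (AlgebraicClosure F)) (v 0) (v 1) (v 2) =
        t • fun i => algebraMap F (AlgebraicClosure F) (l i)

/-- A line of `P²(F_q)` intersects `E` in three distinct `F_q`-rational points. -/
def IsThreeSecant (W : WeierstrassCurve F) (l : Fin 3 → F) : Prop :=
  ∃ u v w : Projectivization F (Fin 3 → F), u ≠ v ∧ u ≠ w ∧ v ≠ w ∧
    OnCurve W u ∧ OnCurve W v ∧ OnCurve W w ∧ OnHyp l u ∧ OnHyp l v ∧ OnHyp l w

section Stepanov

open Polynomial

variable {K : Type} [Field K]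

/-- `p(u, t)`, a polynomial in `u` over `K[t]`, has degree at most `k` in `u` and `a` in `t`. -/
def BiDeg (p : Polynomial K[X]) (k a : ℕ) : Prop :=
  p.natDegree ≤ k ∧ ∀ i, (p.coeff i).natDegree ≤ a

lemma BiDeg.mono {p : Polynomial K[X]} {k a k' a' : ℕ} (h : BiDeg p k a) (hk : k ≤ k')
    (ha : a ≤ a') : BiDeg p k' a' :=
  ⟨h.1.trans hk, fun i => (h.2 i).trans ha⟩

lemma BiDeg.add {p r : Polynomial K[X]} {k a : ℕ} (hp : BiDeg p k a) (hr : BiDeg r k a) :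
    BiDeg (p + r) k a :=
  ⟨natDegree_add_le_of_degree_le hp.1 hr.1, fun i => by
    rw [coeff_add]; exact natDegree_add_le_of_degree_le (hp.2 i) (hr.2 i)⟩

lemma BiDeg.sub {p r : Polynomial K[X]} {k a : ℕ} (hp : BiDeg p k a) (hr : BiDeg r k a) :
    BiDeg (p - r) k a :=
  ⟨(natDegree_sub_le _ _).trans (max_le hp.1 hr.1), fun i => by
    rw [coeff_sub]; exact (natDegree_sub_le _ _).trans (max_le (hp.2 i) (hr.2 i))⟩

lemma BiDeg.sum {ι : Type*} (s : Finset ι) {f : ι → Polynomial K[X]} {k a : ℕ}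
    (h : ∀ i ∈ s, BiDeg (f i) k a) : BiDeg (∑ i ∈ s, f i) k a :=
  ⟨natDegree_sum_le_of_forall_le s f fun i hi => (h i hi).1, fun j => by
    rw [finsetSum_coeff]
    exact natDegree_sum_le_of_forall_le s _ fun i hi => (h i hi).2 j⟩

lemma BiDeg.mul {p r : Polynomial K[X]} {k a k' a' : ℕ} (hp : BiDeg p k a)
    (hr : BiDeg r k' a') : BiDeg (p * r) (k + k') (a + a') :=
  ⟨natDegree_mul_le_of_le hp.1 hr.1, fun i => by
    rw [coeff_mul]
    exact natDegree_sum_le_of_forall_le _ _ fun x _ =>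
      natDegree_mul_le_of_le (hp.2 x.1) (hr.2 x.2)⟩

lemma BiDeg.monomial {i j k a : ℕ} (c : K) (hi : i ≤ k) (hj : j ≤ a) :
    BiDeg (monomial i (monomial j c)) k a := by
  refine ⟨(natDegree_monomial_le _).trans hi, fun l => ?_⟩
  rw [coeff_monomial]
  split_ifs
  · exact (natDegree_monomial_le _).trans hj
  · simp

lemma BiDeg.derivative {p : Polynomial K[X]} {k a : ℕ} (h : BiDeg p (k + 1) a) :
    BiDeg (derivative p) k a := by
  refine ⟨(natDegree_derivative_le p).trans (by have := h.1; omega), fun i => ?_⟩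
  rw [coeff_derivative]
  refine (natDegree_mul_le_of_le (h.2 _) (n := 0) ?_)
  exact_mod_cast (natDegree_natCast (R := K) (i + 1)).le

lemma BiDeg.natDegree_eval_le {p : Polynomial K[X]} {k a d e : ℕ} (h : BiDeg p k a)
    {r : K[X]} (hr : r.natDegree ≤ d) (he : k * d + a ≤ e) : (p.eval r).natDegree ≤ e := by
  rw [eval_eq_sum_range]
  refine natDegree_sum_le_of_forall_le _ _ fun i hi => ?_
  have hi' : i ≤ k := (Nat.lt_succ_iff.mp (Finset.mem_range.mp hi)).trans h.1
  calc _ ≤ a + i * d :=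
        natDegree_mul_le_of_le (h.2 i) (natDegree_pow_le_of_le i hr)
    _ ≤ e := by nlinarith [Nat.mul_le_mul_right d hi']

lemma BiDeg.exists_eq_diag_mul {p : Polynomial K[X]} {k a : ℕ} (h : BiDeg p (k + 1) (a + 1))
    (h0 : p.eval X = 0) : ∃ r, p = (X - C X) * r ∧ BiDeg r k a := by
  obtain ⟨r, hr⟩ := dvd_iff_isRoot.mpr h0
  refine ⟨r, hr, ?_, ?_⟩
  · by_cases h1 : r = 0
    · simp [h1]
    · have := h.1
      rw [hr, natDegree_mul (X_sub_C_ne_zero _) h1, natDegree_X_sub_C] at this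
      omega
  · intro i
    have key : ∀ s : K[X], (X * s).natDegree ≤ a + 1 → s.natDegree ≤ a := by
      intro s hs
      by_cases h1 : s = 0
      · simp [h1]
      · rw [natDegree_X_mul h1] at hs; omega
    induction i with
    | zero =>
      apply key
      have : X * r.coeff 0 = - p.coeff 0 := by
        rw [hr, sub_mul, coeff_sub, coeff_C_mul]; simp
      rw [this, natDegree_neg]; exact h.2 0
    | succ i ih =>
      apply key
      have : X * r.coeff (i + 1) = r.coeff i - p.coeff (i + 1) := by
        rw [hr, sub_mul, coeff_sub, coeff_C_mul, coeff_X_mul]; ring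
      rw [this]
      exact (natDegree_sub_le _ _).trans (max_le (ih.trans (by omega)) (h.2 _))

lemma BiDeg.exists_eq_diag_sq_mul {p : Polynomial K[X]} {k a : ℕ}
    (h : BiDeg p (k + 2) (a + 2)) (h0 : p.eval X = 0) (h1 : (Polynomial.derivative p).eval X = 0) :
    ∃ r, p = (X - C X) ^ 2 * r ∧ BiDeg r k a := by
  obtain ⟨r, rfl, hr'⟩ := h.exists_eq_diag_mul h0
  have hr0 : r.eval X = 0 := by simpa using h1
  obtain ⟨s, rfl, hs⟩ := hr'.exists_eq_diag_mul hr0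
  exact ⟨s, by ring, hs⟩

lemma finrank_le_finrank_ker_add {V : Type} [AddCommGroup V] [Module K V] [FiniteDimensional K V]
    (φ : V →ₗ[K] K[X]) (d : ℕ) (h : ∀ v, (φ v).natDegree ≤ d) :
    Module.finrank K V ≤ Module.finrank K (LinearMap.ker φ) + (d + 1) := by
  have h1 := φ.finrank_range_add_finrank_ker
  have h2 : LinearMap.range φ ≤ degreeLT K (d + 1) := by
    rintro _ ⟨v, rfl⟩
    rw [mem_degreeLT]
    exact degree_le_natDegree.trans_lt (by exact_mod_cast Nat.lt_succ_of_le (h v))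
  have : Module.Finite K (degreeLT K (d + 1)) :=
    Module.Finite.equiv (degreeLTEquiv K (d + 1)).symm
  have h3 := Submodule.finrank_mono h2
  rw [(degreeLTEquiv K (d + 1)).finrank_eq, Module.finrank_fin_fun] at h3
  omega

/-- Writing `s² = H(u)H(t) = P² + (u - t)²Q`, the function `A + sB` can be divided `l` times by
`(u - t)²/(s + P)` without leaving the polynomials in `u`, `t`, `s`; if `ε ≠ 0`, the last quotient
vanishes moreover on the diagonal. -/
def DiagChain (P Q : Polynomial K[X]) (ε : ℕ) : ℕ → Polynomial K[X] → Polynomial K[X] → Prop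
  | 0, A, B => ε ≠ 0 → (A + P * B).eval X = 0
  | l + 1, A, B => ∃ B', A + P * B = (X - C X) ^ 2 * B' ∧ DiagChain P Q ε l (P * B' + Q * B) B'

/-- A bound for the number of linear conditions imposed by `DiagChain`. -/
def chainConds (e ε : ℕ) : ℕ → ℕ → ℕ → ℕ
  | 0, k, a => ε * (k + a + 2 * e + 5)
  | l + 1, k, a => 2 * (k + a + 2 * e + 4) + 1 + chainConds e ε l (k + e) (a + e)

lemma exists_diagChain {P Q : Polynomial K[X]} {e : ℕ} (hP : BiDeg P (e + 2) (e + 2))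
    (hQ : BiDeg Q (2 * e + 2) (2 * e + 2)) (ε l : ℕ) :
    ∀ (k a : ℕ) (V : Type) [AddCommGroup V] [Module K V] [FiniteDimensional K V]
      (α β : V →ₗ[K] Polynomial K[X]), (∀ v, BiDeg (α v) (k + e + 2) (a + e + 2)) →
      (∀ v, BiDeg (β v) k a) → chainConds e ε l k a < Module.finrank K V →
      ∃ v ≠ 0, DiagChain P Q ε l (α v) (β v) := by
  have hC : ∀ {A B : Polynomial K[X]} {k a : ℕ}, BiDeg A (k + e + 2) (a + e + 2) → BiDeg B k a →
      BiDeg (A + P * B) (k + e + 2) (a + e + 2) := fun hA hB =>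
    hA.add ((hP.mul hB).mono (by omega) (by omega))
  have hlin : ∀ {V : Type} [AddCommGroup V] [Module K V] (α β : V →ₗ[K] Polynomial K[X]),
      ∃ γ : V →ₗ[K] Polynomial K[X], ∀ v, γ v = α v + P * β v := fun α β =>
    ⟨α + (LinearMap.mulLeft K P).comp β, fun v => rfl⟩
  have hev : ∃ γ : Polynomial K[X] →ₗ[K] K[X], ∀ p, γ p = p.eval X :=
    ⟨(leval (X : K[X])).restrictScalars K, fun p => rfl⟩
  have hdv : ∃ γ : Polynomial K[X] →ₗ[K] Polynomial K[X], ∀ p, γ p = derivative p :=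
    ⟨(derivative (R := K[X])).restrictScalars K, fun p => rfl⟩
  obtain ⟨ev, hev⟩ := hev
  obtain ⟨dv, hdv⟩ := hdv
  induction l with
  | zero =>
    intro k a V _ _ _ α β hα hβ hV
    obtain ⟨γ, hγ⟩ := hlin α β
    rw [chainConds] at hV
    rcases Nat.eq_zero_or_pos ε with rfl | hε
    · have : 0 < Module.finrank K V := by omega
      obtain ⟨v, hv⟩ := Module.finrank_pos_iff_exists_ne_zero.mp this
      exact ⟨v, hv, fun h => absurd rfl h⟩
    · have h1 := finrank_le_finrank_ker_add (ev.comp γ) (k + a + 2 * e + 4) fun v => by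
        rw [LinearMap.comp_apply, hev, hγ]
        exact (hC (hα v) (hβ v)).natDegree_eval_le natDegree_X_le (by omega)
      have : 0 < Module.finrank K (LinearMap.ker (ev.comp γ)) := by nlinarith
      obtain ⟨v, hv⟩ := Module.finrank_pos_iff_exists_ne_zero.mp this
      refine ⟨v, fun h => hv (Subtype.ext h), fun _ => ?_⟩
      have := v.2
      rwa [LinearMap.mem_ker, LinearMap.comp_apply, hev, hγ] at this
  | succ l ih =>
    intro k a V _ _ _ α β hα hβ hV
    obtain ⟨γ, hγ⟩ := hlin α β
    rw [chainConds] at hV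
    let V₁ := LinearMap.ker (ev.comp γ)
    have h1 := finrank_le_finrank_ker_add (ev.comp γ) (k + a + 2 * e + 4) fun v => by
      rw [LinearMap.comp_apply, hev, hγ]
      exact (hC (hα v) (hβ v)).natDegree_eval_le natDegree_X_le (by omega)
    let V₂ := LinearMap.ker ((ev.comp (dv.comp γ)).comp V₁.subtype)
    have h2 := finrank_le_finrank_ker_add ((ev.comp (dv.comp γ)).comp V₁.subtype)
      (k + a + 2 * e + 3) fun v => by
        simp only [LinearMap.comp_apply, hev, hdv, hγ]
        exact ((hC (hα _) (hβ _)).derivative (k := k + e + 1)).natDegree_eval_le natDegree_X_le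
          (by omega)
    let ι : V₂ →ₗ[K] V := V₁.subtype.comp V₂.subtype
    have hι : ∀ v, ι v = 0 → v = 0 := fun v h => Subtype.ext (Subtype.ext h)
    have hdiv : ∀ v : V₂, ∃ r, γ (ι v) = (X - C X) ^ 2 * r ∧ BiDeg r (k + e) (a + e) := by
      intro v
      have e1 := v.1.2
      have e2 := v.2
      simp only [V₁, V₂, LinearMap.mem_ker, LinearMap.comp_apply, hev, hdv] at e1 e2
      refine BiDeg.exists_eq_diag_sq_mul ?_ e1 e2
      rw [hγ]; exact hC (hα _) (hβ _)
    choose d hd hd' using hdiv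
    have hne : ((X - C X) ^ 2 : Polynomial K[X]) ≠ 0 := pow_ne_zero _ (X_sub_C_ne_zero _)
    let β' : V₂ →ₗ[K] Polynomial K[X] :=
      { toFun := d
        map_add' := fun v w => mul_left_cancel₀ hne (by
          rw [mul_add, ← hd, ← hd, ← hd, map_add, map_add])
        map_smul' := fun c v => mul_left_cancel₀ hne (by
          rw [RingHom.id_apply, mul_smul_comm, ← hd, ← hd, map_smul, map_smul]) }
    let α' : V₂ →ₗ[K] Polynomial K[X] :=
      (LinearMap.mulLeft K P).comp β' + (LinearMap.mulLeft K Q).comp (β.comp ι)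
    obtain ⟨v, hv, hch⟩ := ih (k + e) (a + e) V₂ α' β'
      (fun v => ((hP.mul (hd' v)).mono (by omega) (by omega)).add
        ((hQ.mul (hβ _)).mono (by omega) (by omega))) hd' (by
          change _ ≤ Module.finrank K V₁ + _ at h1
          change _ ≤ Module.finrank K V₂ + _ at h2
          omega)
    exact ⟨ι v, fun h => hv (hι v h), d v, by rw [← hγ, hd], hch⟩

/-- A polynomial approximation `P(u, t)` of the square root of `H(u)H(t)` along the diagonal. -/
lemma exists_sqrt_approx (h2 : (2 : K) ≠ 0) (H : K[X]) (e : ℕ) (hH : H.natDegree ≤ 2 * e + 4) :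
    ∃ P Q : Polynomial K[X], BiDeg P (e + 2) (e + 2) ∧ BiDeg Q (2 * e + 2) (2 * e + 2) ∧
      P.eval X = H ∧ H.map C * C H = P ^ 2 + (X - C X) ^ 2 * Q ∧
      ∀ t, 2 * (derivative (P.eval (C t))).eval t = (derivative H).eval t := by
  have hsum : H = ∑ i ∈ Finset.range (2 * e + 5), monomial i (H.coeff i) :=
    H.as_sum_range' _ (by omega)
  have hder : derivative H = ∑ i ∈ Finset.range (2 * e + 5), monomial (i - 1) (H.coeff i * i) := by
    conv_lhs => rw [hsum]
    rw [derivative_sum]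
    simp only [derivative_monomial]
  have hi : ∀ i : ℕ, ((i / 2 : ℕ) : K) + ((i + 1) / 2 : ℕ) = i := fun i => by
    rw [← Nat.cast_add]; congr 1; omega
  let P : Polynomial K[X] := ∑ i ∈ Finset.range (2 * e + 5),
    (monomial (i / 2) (monomial ((i + 1) / 2) (H.coeff i / 2)) +
      monomial ((i + 1) / 2) (monomial (i / 2) (H.coeff i / 2)))
  have hP : BiDeg P (e + 2) (e + 2) := BiDeg.sum _ fun i hi => by
    have := Finset.mem_range.mp hi
    exact (BiDeg.monomial _ (by omega) (by omega)).add (BiDeg.monomial _ (by omega) (by omega))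
  have hPX : P.eval X = H := by
    conv_rhs => rw [hsum]
    simp only [P, eval_finsetSum, eval_add, eval_monomial, monomial_mul_X_pow]
    refine Finset.sum_congr rfl fun i _ => ?_
    rw [show (i + 1) / 2 + i / 2 = i by omega, show i / 2 + (i + 1) / 2 = i by omega, ← map_add]
    congr 1; field_simp; ring
  have hPd : 2 * (derivative P).eval X = derivative H := by
    rw [hder]
    simp only [P, derivative_sum, derivative_add, derivative_monomial, eval_finsetSum, eval_add,
      eval_monomial, Finset.mul_sum]
    refine Finset.sum_congr rfl fun i _ => ?_
    have aux : ∀ a b : ℕ, a + b = i →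
        monomial b (H.coeff i / 2) * (a : K[X]) * X ^ (a - 1) =
          monomial (i - 1) (H.coeff i / 2 * a) := by
      intro a b hab
      rcases Nat.eq_zero_or_pos a with rfl | ha
      · simp
      · rw [← C_eq_natCast, monomial_mul_C, monomial_mul_X_pow]
        congr 2; omega
    rw [aux _ _ (by omega), aux _ _ (by omega), ← map_add, ← mul_add, hi, ← C_ofNat,
      C_mul_monomial]
    congr 1; field_simp
  have hPt : ∀ t, 2 * (derivative (P.eval (C t))).eval t = (derivative H).eval t := by
    intro t
    rw [hder]
    simp only [P, eval_finsetSum, eval_add, eval_monomial, ← C_pow, monomial_mul_C, derivative_sum,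
      derivative_add, derivative_monomial, Finset.mul_sum]
    refine Finset.sum_congr rfl fun i _ => ?_
    have aux : ∀ a b : ℕ, a + b = i →
        H.coeff i / 2 * t ^ a * b * t ^ (b - 1) = H.coeff i / 2 * b * t ^ (i - 1) := by
      intro a b hab
      rcases Nat.eq_zero_or_pos b with rfl | hb
      · simp
      · rw [show i - 1 = a + (b - 1) by omega, pow_add]; ring
    rw [aux _ _ (by omega), aux _ _ (by omega), ← hi i]
    field_simp
    ring
  have hHb : BiDeg (H.map C * C H) (2 * e + 4) (2 * e + 4) := by
    refine ⟨(natDegree_mul_le_of_le (n := 0) (natDegree_map_le.trans hH) (by simp)), fun i => ?_⟩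
    rw [coeff_mul_C, coeff_map]
    exact (natDegree_C_mul_le _ _).trans hH
  have hHm : (H.map C).eval (X : K[X]) = H := by
    rw [eval_map]; exact eval₂_C_X
  have hHd : ((derivative H).map C).eval (X : K[X]) = derivative H := by
    rw [eval_map]; exact eval₂_C_X
  obtain ⟨Q, hQ, hQ'⟩ := BiDeg.exists_eq_diag_sq_mul (k := 2 * e + 2) (a := 2 * e + 2)
    (p := H.map C * C H - P ^ 2)
    (hHb.sub (by rw [pow_two]; exact (hP.mul hP).mono (by omega) (by omega))) (by
      simp only [eval_sub, eval_mul, hHm, hPX, eval_C, eval_pow]; ring) (by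
      simp only [derivative_sub, derivative_mul, derivative_map, derivative_C, pow_two,
        eval_sub, eval_add, eval_mul, hHd, hPX, eval_C, mul_zero, eval_zero]
      linear_combination (-H) * hPd)
  exact ⟨P, Q, hP, hQ', hPX, by linear_combination hQ, hPt⟩

lemma pow_dvd_of_dvd_mul_of_eval_ne_zero {p r : K[X]} {t : K} {n : ℕ} (hp : p.eval t ≠ 0)
    (h : (X - C t) ^ n ∣ p * r) : (X - C t) ^ n ∣ r := by
  refine IsCoprime.dvd_of_dvd_mul_left (IsCoprime.pow_left ?_) h
  rw [(irreducible_X_sub_C t).coprime_iff_not_dvd, dvd_iff_isRoot]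
  exact hp

/-- Substituting a point of the curve for `u` in a diagonal chain. -/
lemma DiagChain.pow_dvd {P Q : Polynomial K[X]} {r s : K[X]} {t : K} (hr : X - C t ∣ r - X)
    (hs : s ^ 2 = P.eval r ^ 2 + (r - X) ^ 2 * Q.eval r) (ht : (s + P.eval r).eval t ≠ 0)
    {ε : ℕ} (hε : ε ≤ 1) (l : ℕ) : ∀ {A B : Polynomial K[X]}, DiagChain P Q ε l A B →
      (X - C t) ^ (2 * l + ε) ∣ A.eval r + s * B.eval r := by
  induction l with
  | zero =>
    intro A B h
    rcases Nat.le_one_iff_eq_zero_or_eq_one.mp hε with rfl | rfl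
    · simp
    obtain ⟨D, hD⟩ := dvd_iff_isRoot.mpr (h one_ne_zero)
    refine pow_dvd_of_dvd_mul_of_eval_ne_zero ht ?_
    have hD' := congrArg (eval r) hD
    simp only [eval_add, eval_mul, eval_sub, eval_X, eval_C] at hD'
    have : (s + P.eval r) * (A.eval r + s * B.eval r) =
        (r - X) * ((s + P.eval r) * D.eval r + (r - X) * Q.eval r * B.eval r) := by
      linear_combination (s + P.eval r) * hD' + B.eval r * hs
    rw [this]
    simpa using hr.mul_right _
  | succ l ih =>
    rintro A B ⟨B', hB', hch⟩
    refine pow_dvd_of_dvd_mul_of_eval_ne_zero ht ?_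
    have hD' := congrArg (eval r) hB'
    simp only [eval_add, eval_mul, eval_sub, eval_X, eval_C, eval_pow] at hD'
    have : (s + P.eval r) * (A.eval r + s * B.eval r) =
        (r - X) ^ 2 * ((P * B' + Q * B).eval r + s * B'.eval r) := by
      simp only [eval_add, eval_mul]
      linear_combination (s + P.eval r) * hD' + B.eval r * hs
    rw [this, show 2 * (l + 1) + ε = 2 + (2 * l + ε) by ring, pow_add]
    exact mul_dvd_mul (pow_dvd_pow_of_dvd hr 2) (ih hch)

/-- Substituting a branch point for `u` in a diagonal chain. -/
lemma DiagChain.pow_dvd_eval_C {P Q : Polynomial K[X]} {p : K[X]} {t : K}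
    (hp : P.eval (C t) = (X - C t) * p) (hQ : p ^ 2 = - Q.eval (C t)) (ht : p.eval t ≠ 0)
    {ε : ℕ} (l : ℕ) : ∀ {A B : Polynomial K[X]}, DiagChain P Q ε l A B →
      (X - C t) ^ l ∣ A.eval (C t) := by
  induction l with
  | zero => intro A B _; simp
  | succ l ih =>
    rintro A B ⟨B', hB', hch⟩
    refine pow_dvd_of_dvd_mul_of_eval_ne_zero ht ?_
    have hD' := congrArg (eval (C t)) hB'
    simp only [eval_add, eval_mul, eval_sub, eval_X, eval_C, eval_pow, hp] at hD'
    have : p * A.eval (C t) = (X - C t) * (P * B' + Q * B).eval (C t) := by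
      simp only [eval_add, eval_mul, hp]
      linear_combination p * hD' - (X - C t) * B.eval (C t) * hQ
    rw [this, pow_succ']
    exact mul_dvd_mul_left _ (ih hch)

/-- The polynomial in two variables with given coefficients. -/
noncomputable def biPoly (m n : ℕ) : (Fin m × Fin n → K) →ₗ[K] Polynomial K[X] where
  toFun f := ∑ i : Fin m, ∑ j : Fin n, monomial i (monomial j (f (i, j)))
  map_add' f g := by simp [Finset.sum_add_distrib]
  map_smul' c f := by
    simp [Finset.smul_sum, smul_monomial]

lemma biPoly_biDeg (m n : ℕ) (f : Fin (m + 1) × Fin (n + 1) → K) :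
    BiDeg (biPoly (m + 1) (n + 1) f) m n := by
  change BiDeg (∑ i : Fin (m + 1), ∑ j : Fin (n + 1), monomial i (monomial j (f (i, j)))) m n
  exact BiDeg.sum _ fun i _ => BiDeg.sum _ fun j _ =>
    BiDeg.monomial _ (Nat.lt_succ_iff.mp i.2) (Nat.lt_succ_iff.mp j.2)

lemma biPoly_injective (m n : ℕ) : Function.Injective (biPoly (K := K) m n) := by
  rw [injective_iff_map_eq_zero]
  intro f hf
  ext ⟨i, j⟩
  have : ((biPoly m n f).coeff i).coeff j = f (i, j) := by
    simp [biPoly, coeff_monomial, Fin.val_inj]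
  simpa [hf] using this.symm

lemma eq_zero_of_eval_X_pow_eq_zero {q : ℕ} (k : ℕ) : ∀ {G : Polynomial K[X]},
    G.natDegree < k → (∀ i, (G.coeff i).natDegree < q) → G.eval (X ^ q) = 0 → G = 0 := by
  induction k with
  | zero => intro G h; omega
  | succ k ih =>
    intro G hk hG h0
    have hd := G.divX_mul_X_add
    have h1 : G.coeff 0 = 0 := by
      have : X ^ q ∣ G.coeff 0 := by
        rw [← hd] at h0
        simp only [eval_add, eval_mul, eval_X, eval_C] at h0
        exact ⟨-(G.divX.eval (X ^ q)), by linear_combination h0⟩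
      refine eq_zero_of_dvd_of_natDegree_lt this ?_
      rw [natDegree_X_pow]; exact hG 0
    rw [h1, map_zero, add_zero] at hd
    have h2 : G.divX.eval (X ^ q) = 0 := by
      rw [← hd, eval_mul, eval_X] at h0
      exact (mul_eq_zero.mp h0).resolve_right (pow_ne_zero _ X_ne_zero)
    rcases Nat.eq_zero_or_pos G.natDegree with hz | hz
    · rw [eq_C_of_natDegree_eq_zero hz, h1, map_zero]
    · have := ih (G := G.divX) (by rw [natDegree_divX_eq_natDegree_tsub_one]; omega)
        (fun i => by rw [coeff_divX]; exact hG _) h2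
      rw [← hd, this, zero_mul]

/-- No nonzero multiple of `H` is a square. -/
def NonSq {K : Type} [Field K] (H : K[X]) : Prop := ∀ κ : K, κ ≠ 0 → ∀ S : K[X], C κ * H ≠ S ^ 2

lemma NonSq.ne_zero {K : Type} [Field K] {H : K[X]} (h : NonSq H) : H ≠ 0 := fun h0 =>
  h 1 one_ne_zero 0 (by simp [h0])

lemma sum_le_natDegree_of_pow_dvd {K : Type} [Field K] {R : K[X]} (hR : R ≠ 0) (s : Finset K)
    (m : K → ℕ) (h : ∀ t ∈ s, (X - C t) ^ m t ∣ R) : ∑ t ∈ s, m t ≤ R.natDegree := by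
  have hdvd : ∏ t ∈ s, (X - C t) ^ m t ∣ R := by
    refine Finset.prod_dvd_of_coprime (fun x _ y _ hxy => ?_) h
    exact IsCoprime.pow (pairwise_coprime_X_sub_C Function.injective_id hxy)
  have h1 := natDegree_le_of_dvd hdvd hR
  rw [natDegree_prod_of_monic _ _ fun t _ => (monic_X_sub_C t).pow _] at h1
  simpa using h1

/-- A zero of `A + sB` on the curve `s² = H(X^q)H` forces `A = B = 0` in small degrees. -/
lemma eq_zero_of_eval_add_mul_eval_eq_zero {H s : F[X]}
    (hs : s ^ 2 = (H.map C * C H).eval (X ^ Fintype.card F)) (hH : NonSq H)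
    {A B : Polynomial F[X]} {e k a : ℕ} (hHd : H.natDegree ≤ 2 * e + 4)
    (hA : BiDeg A (k + e + 2) (a + e + 2)) (hB : BiDeg B k a)
    (hq : 2 * (a + e + 2) < Fintype.card F) (hq' : k + 2 * e + 4 < Fintype.card F)
    (h0 : A.eval (X ^ Fintype.card F) + s * B.eval (X ^ Fintype.card F) = 0) : A = 0 ∧ B = 0 := by
  have hHb : BiDeg (H.map C * C H) (2 * e + 4) (2 * e + 4) := by
    refine ⟨(natDegree_mul_le_of_le (n := 0) (natDegree_map_le.trans hHd) (by simp)), fun i => ?_⟩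
    rw [coeff_mul_C, coeff_map]
    exact (natDegree_C_mul_le _ _).trans hHd
  have hG : A * A - H.map C * C H * (B * B) = 0 := by
    have hdeg : BiDeg (A * A - H.map C * C H * (B * B)) (2 * (k + e + 2)) (2 * (a + e + 2)) :=
      ((hA.mul hA).mono (by omega) (by omega)).sub
        ((hHb.mul (hB.mul hB)).mono (by omega) (by omega))
    refine eq_zero_of_eval_X_pow_eq_zero (q := Fintype.card F) _ (Nat.lt_succ_of_le hdeg.1)
      (fun i => (hdeg.2 i).trans_lt hq) ?_
    rw [eval_sub, eval_mul (p := H.map C * C H), ← hs, eval_mul, eval_mul]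
    linear_combination (A.eval (X ^ Fintype.card F) - s * B.eval (X ^ Fintype.card F)) * h0
  by_cases hB0 : B = 0
  · rw [hB0, zero_mul, mul_zero, sub_zero] at hG
    exact ⟨mul_self_eq_zero.mp hG, hB0⟩
  exfalso
  have hm : H.map (C : F →+* F[X]) ≠ 0 := (Polynomial.map_ne_zero_iff C_injective).mpr hH.ne_zero
  obtain ⟨u, hu⟩ : ∃ u : F, (H.map C * B).eval (C u) ≠ 0 := by
    by_contra! hall
    refine mul_ne_zero hm hB0 (eq_zero_of_natDegree_lt_card_of_eval_eq_zero _ C_injective hall ?_)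
    refine (natDegree_mul_le_of_le (natDegree_map_le.trans hHd) hB.1).trans_lt (by omega)
  rw [eval_mul, eval_map, eval₂_at_apply] at hu
  have hu1 : H.eval u ≠ 0 := fun h => hu (by rw [h]; simp)
  have hu2 : B.eval (C u) ≠ 0 := right_ne_zero_of_mul hu
  have h1 := congrArg (eval (C u)) hG
  simp only [eval_sub, eval_mul, eval_map, eval₂_at_apply, eval_C, eval_zero] at h1
  have h2 : B.eval (C u) ^ 2 ∣ A.eval (C u) ^ 2 :=
    ⟨C (H.eval u) * H, by linear_combination h1⟩
  obtain ⟨S, hS⟩ := (IsIntegrallyClosed.pow_dvd_pow_iff two_ne_zero).mp h2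
  refine hH _ hu1 S (mul_left_cancel₀ (pow_ne_zero 2 hu2) ?_)
  rw [← mul_pow, ← hS]
  linear_combination -h1

/-- Stepanov's bound for the number of nonsquare values of a polynomial. -/
theorem stepanov_bound (hodd : Odd (Fintype.card F)) {H : F[X]} (hH : NonSq H) (e k a l ε : ℕ)
    (hHd : H.natDegree ≤ 2 * e + 4) (hε : ε ≤ 1) (hl : 2 * l ≤ Fintype.card F)
    (hq : 2 * (a + e + 2) < Fintype.card F) (hq' : k + 2 * e + 4 < Fintype.card F)
    (hconds : chainConds e ε l k a < (k + e + 3) * (a + e + 3) + (k + 1) * (a + 1)) :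
    (2 * l + ε) * (Finset.univ.filter fun t => ¬ IsSquare (H.eval t)).card +
      l * (Finset.univ.filter fun t => H.eval t = 0 ∧ (derivative H).eval t ≠ 0).card ≤
      Fintype.card F * (k + e + 2) + (a + e + 2) := by
  set q := Fintype.card F with hqdef
  obtain ⟨m, hm⟩ := hodd
  have hchar : ringChar F ≠ 2 := fun h => by
    have := FiniteField.even_card_iff_char_two.mp h
    omega
  have h2 : (2 : F) ≠ 0 := Ring.two_ne_zero hchar
  obtain ⟨P, Q, hP, hQ, hPX, hPQ, hPt⟩ := exists_sqrt_approx h2 H e hHd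
  let V := (Fin (k + e + 3) × Fin (a + e + 3) → F) × (Fin (k + 1) × Fin (a + 1) → F)
  let α : V →ₗ[F] Polynomial F[X] := (biPoly (k + e + 3) (a + e + 3)).comp (LinearMap.fst F _ _)
  let β : V →ₗ[F] Polynomial F[X] := (biPoly (k + 1) (a + 1)).comp (LinearMap.snd F _ _)
  obtain ⟨v, hv, hch⟩ := exists_diagChain hP hQ ε l k a V α β
    (fun v => biPoly_biDeg (k + e + 2) (a + e + 2) v.1) (fun v => biPoly_biDeg k a v.2) (by
      simpa [V] using hconds)
  have hA : BiDeg (α v) (k + e + 2) (a + e + 2) := biPoly_biDeg _ _ v.1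
  have hB : BiDeg (β v) k a := biPoly_biDeg _ _ v.2
  have hAB : ¬ (α v = 0 ∧ β v = 0) := fun h => hv (Prod.ext
    (biPoly_injective _ _ (h.1.trans (map_zero _).symm))
    (biPoly_injective _ _ (h.2.trans (map_zero _).symm)))
  generalize α v = A at hch hA hAB
  generalize β v = B at hch hB hAB
  have hmap : (H.map C).eval (X ^ q : F[X]) = H ^ q := by
    rw [← FiniteField.expand_card H, expand_eq_comp_X_pow, eval_map]; rfl
  let s : F[X] := - H ^ (m + 1)
  have hs : s ^ 2 = (H.map C * C H).eval (X ^ q) := by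
    rw [eval_mul, hmap, eval_C, hm]; simp only [s]; ring
  set R := A.eval (X ^ q) + s * B.eval (X ^ q) with hRdef
  have hR : R ≠ 0 := fun h0 =>
    hAB (eq_zero_of_eval_add_mul_eval_eq_zero hs hH hHd hA hB hq hq' h0)
  have hRdeg : R.natDegree ≤ q * (k + e + 2) + (a + e + 2) := by
    have hsd : s.natDegree ≤ (q + 1) * (e + 2) := by
      rw [natDegree_neg]
      refine (natDegree_pow_le_of_le (m + 1) hHd).trans ?_
      rw [hm]; nlinarith
    refine natDegree_add_le_of_degree_le
      (hA.natDegree_eval_le (natDegree_X_pow_le q) (by nlinarith)) ?_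
    refine (natDegree_mul_le_of_le hsd
      (hB.natDegree_eval_le (natDegree_X_pow_le q) le_rfl)).trans ?_
    nlinarith
  set T := Finset.univ.filter fun t => ¬ IsSquare (H.eval t) with hT
  set Z := Finset.univ.filter fun t => H.eval t = 0 ∧ (derivative H).eval t ≠ 0 with hZ
  have hdisj : Disjoint T Z := by
    rw [Finset.disjoint_filter]
    intro t _ h1 h3
    exact h1 (by rw [h3.1]; exact IsSquare.zero)
  have hfrob : ∀ t : F, (X ^ q - C t : F[X]) = (X - C t) ^ q := fun t => by
    rw [← FiniteField.expand_card (X - C t)]; simp [q]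
  have hTdvd : ∀ t ∈ T, (X - C t) ^ (2 * l + ε) ∣ R := by
    intro t ht
    have ht : ¬ IsSquare (H.eval t) := (Finset.mem_filter.mp ht).2
    have ht0 : H.eval t ≠ 0 := fun h => ht (by rw [h]; exact IsSquare.zero)
    have hpow : H.eval t ^ m = -1 := by
      have h3 := FiniteField.pow_dichotomy hchar ht0
      have h4 := FiniteField.isSquare_iff hchar ht0
      rw [← hqdef, show q / 2 = m by omega] at h3 h4
      exact h3.resolve_left fun h => ht (h4.mpr h)
    refine DiagChain.pow_dvd ?_ ?_ ?_ hε l hch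
    · rw [dvd_iff_isRoot]
      simp [IsRoot, q, FiniteField.pow_card]
    · rw [hs, hPQ]; simp
    · have : (P.eval (X ^ q)).eval t = H.eval t := by
        have h5 := sub_dvd_eval_sub (X ^ q) X P
        obtain ⟨D, hD⟩ := h5
        have := congrArg (eval t) hD
        simp only [eval_sub, eval_mul, eval_pow, eval_X, hPX, q, FiniteField.pow_card, sub_self,
          zero_mul] at this
        exact sub_eq_zero.mp this
      rw [eval_add, this, eval_neg, eval_pow, pow_succ, hpow]
      intro h
      exact mul_ne_zero h2 ht0 (by linear_combination h)
  have hZdvd : ∀ t ∈ Z, (X - C t) ^ l ∣ R := by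
    intro t ht
    obtain ⟨ht0, ht1⟩ := (Finset.mem_filter.mp ht).2
    have hp0 : X - C t ∣ P.eval (C t) := by
      obtain ⟨D, hD⟩ := sub_dvd_eval_sub (C t) X P
      have := congrArg (eval t) hD
      simp only [eval_sub, eval_mul, eval_C, eval_X, hPX, ht0, sub_self, zero_mul, sub_zero] at this
      exact dvd_iff_isRoot.mpr this
    obtain ⟨p, hp⟩ := hp0
    have hpt : p.eval t ≠ 0 := fun h => ht1 (by
      rw [← hPt, hp]; simp [h])
    have hpQ : p ^ 2 = - Q.eval (C t) := by
      have h3 := congrArg (eval (C t)) hPQ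
      simp only [eval_mul, eval_map, eval₂_at_apply, ht0, eval_add, eval_pow, hp, eval_sub, eval_X,
        eval_C, map_zero, zero_mul] at h3
      refine mul_left_cancel₀ (pow_ne_zero 2 (X_sub_C_ne_zero t)) ?_
      linear_combination -h3
    have h4 := DiagChain.pow_dvd_eval_C hp hpQ hpt l hch
    have h5 : (X - C t) ^ l ∣ A.eval (X ^ q) := by
      have h6 := sub_dvd_eval_sub (X ^ q) (C t) A
      rw [hfrob] at h6
      simpa using dvd_add ((pow_dvd_pow _ (by omega : l ≤ q)).trans h6) h4
    have h7 : (X - C t) ^ l ∣ s := by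
      rw [dvd_neg]
      exact (pow_dvd_pow _ (by omega)).trans (pow_dvd_pow_of_dvd (dvd_iff_isRoot.mpr ht0) (m + 1))
    exact dvd_add h5 (h7.mul_right _)
  have hfin := sum_le_natDegree_of_pow_dvd hR (T ∪ Z) (fun t => if t ∈ T then 2 * l + ε else l)
    (fun t ht => by
      split_ifs with h
      · exact hTdvd t h
      · exact hZdvd t ((Finset.mem_union.mp ht).resolve_left h))
  rw [Finset.sum_union hdisj, Finset.sum_congr rfl (g := fun _ => 2 * l + ε) (by
      intro t ht; simp [ht]), Finset.sum_congr (s₁ := Z) rfl (g := fun _ => l) (by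
      intro t ht; simp [Finset.disjoint_right.mp hdisj ht]), Finset.sum_const, Finset.sum_const,
      smul_eq_mul, smul_eq_mul] at hfin
  linarith

end Stepanov

section Cubic

open Polynomial

/-- The discriminant of the cubic `x³ + ax² + bx + c`. -/
def cubicDisc {R : Type} [CommRing R] (a b c : R) : R :=
  a ^ 2 * b ^ 2 - 4 * b ^ 3 - 4 * a ^ 3 * c + 18 * a * b * c - 27 * c ^ 2

lemma deriv_ne_zero_of_cubicDisc_ne_zero {R : Type} [CommRing R] {a b c x : R}
    (h : cubicDisc a b c ≠ 0) (hx : x ^ 3 + a * x ^ 2 + b * x + c = 0) :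
    3 * x ^ 2 + 2 * a * x + b ≠ 0 := fun hx' => h <| by
  have hb : b = -3 * x ^ 2 - 2 * a * x := by linear_combination hx'
  have hc : c = 2 * x ^ 3 + a * x ^ 2 := by linear_combination hx - x * hx'
  subst hb hc
  rw [cubicDisc]; ring

/-- The affine points of `y² = x³ + ax² + bx + c`. -/
def affPoints (a b c : F) : Finset (F × F) :=
  Finset.univ.filter fun p => p.2 ^ 2 = p.1 ^ 3 + a * p.1 ^ 2 + b * p.1 + c

lemma card_filter_sq_eq (h2 : (2 : F) ≠ 0) (v : F) :
    2 ≤ (Finset.univ.filter fun y : F => y ^ 2 = v).card + (if ¬ IsSquare v then 2 else 0) +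
      (if v = 0 then 1 else 0) := by
  by_cases hv : v = 0
  · have : (0 : F) ∈ Finset.univ.filter fun y : F => y ^ 2 = v := by simp [hv]
    have := Finset.card_pos.mpr ⟨_, this⟩
    simp only [hv, if_true] at *
    omega
  by_cases hs : IsSquare v
  · obtain ⟨r, rfl⟩ := hs
    have hr : r ≠ -r := fun h => hv (by
      have : 2 * r = 0 := by linear_combination h
      rw [(mul_eq_zero.mp this).resolve_left h2, mul_zero])
    have : ({r, -r} : Finset F) ⊆ Finset.univ.filter fun y : F => y ^ 2 = r * r := by
      intro y hy
      rcases Finset.mem_insert.mp hy with rfl | hy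
      · simp [pow_two]
      · rw [Finset.mem_singleton.mp hy]; simp [pow_two]
    have := Finset.card_le_card this
    rw [Finset.card_pair hr] at this
    omega
  · rw [if_pos hs]; omega

lemma card_affPoints (a b c : F) : (affPoints a b c).card =
    ∑ x, (Finset.univ.filter fun y : F => y ^ 2 = x ^ 3 + a * x ^ 2 + b * x + c).card := by
  rw [affPoints, Finset.card_filter, Fintype.sum_prod_type]
  simp only [Finset.card_filter]

/-- A lower bound of Hasse type. -/
lemma le_card_affPoints (hq : 121 ≤ Fintype.card F) (hodd : Odd (Fintype.card F)) {a b c : F}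
    (hD : cubicDisc a b c ≠ 0) : 8 * Fintype.card F ≤ 9 * (affPoints a b c).card + 101 := by
  have h2 : (2 : F) ≠ 0 := Ring.two_ne_zero fun h => by
    have := FiniteField.even_card_iff_char_two.mp h
    have := Nat.odd_iff.mp hodd
    omega
  let f : F[X] := X ^ 3 + C a * X ^ 2 + C b * X + C c
  have hev : ∀ x, f.eval x = x ^ 3 + a * x ^ 2 + b * x + c := fun x => by simp [f]
  have hdeg : f.natDegree = 3 := by simp only [f]; compute_degree!
  have hf0 : f ≠ 0 := fun h => by simp [h] at hdeg
  have hns : NonSq f := fun κ hκ S h => by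
    have := congrArg natDegree h
    rw [natDegree_C_mul hκ, hdeg, natDegree_pow] at this
    omega
  have hS := stepanov_bound hodd hns 0 3 47 4 1 (by omega) le_rfl (by omega) (by omega) (by omega)
    (by norm_num [chainConds])
  have hZ : (Finset.univ.filter fun t => f.eval t = 0) =
      Finset.univ.filter fun t => f.eval t = 0 ∧ (derivative f).eval t ≠ 0 := by
    refine Finset.filter_congr fun x _ => ⟨fun h => ⟨h, ?_⟩, And.left⟩
    rw [hev] at h
    have := deriv_ne_zero_of_cubicDisc_ne_zero hD h
    simp only [f]
    simp only [derivative_add, derivative_mul, derivative_C, derivative_X_pow, derivative_X,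
      eval_add, eval_mul, eval_C, eval_pow, eval_X, map_natCast, eval_natCast]
    convert this using 1
    simp
    ring
  rw [← hZ] at hS
  have hZ3 : (Finset.univ.filter fun t => f.eval t = 0).card ≤ 3 := by
    have : (Finset.univ.filter fun t => f.eval t = 0) ⊆ f.roots.toFinset := fun t ht => by
      simpa [hf0] using ht
    exact (Finset.card_le_card this).trans ((Multiset.toFinset_card_le _).trans
      ((card_roots' f).trans hdeg.le))
  have hsum : ∑ _x : F, 2 ≤ ∑ x, ((Finset.univ.filter fun y : F => y ^ 2 = f.eval x).card +
      (if ¬ IsSquare (f.eval x) then 2 else 0) + (if f.eval x = 0 then 1 else 0)) :=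
    Finset.sum_le_sum fun x _ => card_filter_sq_eq h2 _
  rw [Finset.sum_add_distrib, Finset.sum_add_distrib, ← Finset.sum_filter, ← Finset.sum_filter,
    Finset.sum_const, Finset.sum_const, Finset.sum_const] at hsum
  simp only [hev] at hsum hS hZ3
  rw [← card_affPoints] at hsum
  simp only [Finset.card_univ, smul_eq_mul] at hsum
  omega

/-- The discriminant of the restriction of `y² - x³ - ax² - bx - c` to the line
`y = (α + γt) + (β + δt)x`, as a polynomial in `t`. -/
noncomputable def pencilDisc {K : Type} [Field K] (a b c α β γ δ : K) : K[X] :=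
  cubicDisc (C a - (C β + C δ * X) ^ 2) (C b - 2 * (C α + C γ * X) * (C β + C δ * X))
    (C c - (C α + C γ * X) ^ 2)

lemma eval_pencilDisc {K : Type} [Field K] (a b c α β γ δ t : K) :
    (pencilDisc a b c α β γ δ).eval t =
      cubicDisc (a - (β + δ * t) ^ 2) (b - 2 * (α + γ * t) * (β + δ * t)) (c - (α + γ * t) ^ 2) := by
  simp [pencilDisc, cubicDisc]

lemma eval_derivative_pencilDisc {K : Type} [Field K] {a b c α β γ δ t r s : K}
    (h2 : a - (β + δ * t) ^ 2 = - (2 * r + s))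
    (h1 : b - 2 * (α + γ * t) * (β + δ * t) = r ^ 2 + 2 * r * s)
    (h0 : c - (α + γ * t) ^ 2 = - (r ^ 2 * s)) :
    (derivative (pencilDisc a b c α β γ δ)).eval t =
      8 * (r - s) ^ 3 * ((α + γ * t) + (β + δ * t) * r) * (γ + δ * r) := by
  have ha : a = (β + δ * t) ^ 2 - (2 * r + s) := by linear_combination h2
  have hb : b = 2 * (α + γ * t) * (β + δ * t) + r ^ 2 + 2 * r * s := by linear_combination h1
  have hc : c = (α + γ * t) ^ 2 - r ^ 2 * s := by linear_combination h0
  subst ha hb hc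
  simp [pencilDisc, cubicDisc, derivative_pow]
  ring

end Cubic

section Pencil

open Polynomial

lemma exists_roots_of_isSquare_cubicDisc {K : Type} [Field K] (h2 : (2 : K) ≠ 0) {a b c r : K}
    (hr : r ^ 3 + a * r ^ 2 + b * r + c = 0) (h0 : cubicDisc a b c ≠ 0)
    (hs : IsSquare (cubicDisc a b c)) :
    ∃ s z, r ≠ s ∧ r ≠ z ∧ s ≠ z ∧ s ^ 3 + a * s ^ 2 + b * s + c = 0 ∧
      z ^ 3 + a * z ^ 2 + b * z + c = 0 := by
  obtain ⟨d, hd⟩ := hs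
  set u := a + r with hu
  set v := b + r * u with hv
  set m := r ^ 2 + u * r + v with hm
  have hfac : cubicDisc a b c = (u ^ 2 - 4 * v) * m ^ 2 := by
    have hc : c = - r ^ 3 - a * r ^ 2 - b * r := by linear_combination hr
    rw [hm, hv, hu, hc, cubicDisc]; ring
  have hm0 : m ≠ 0 := fun h => h0 (by rw [hfac, h]; ring)
  have hd0 : d ≠ 0 := fun h => h0 (by rw [hd, h]; ring)
  set w := d / m with hw
  have hw0 : w ≠ 0 := div_ne_zero hd0 hm0
  have hww : w ^ 2 = u ^ 2 - 4 * v := by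
    rw [hw, div_pow, div_eq_iff (pow_ne_zero 2 hm0), ← hfac, hd]; ring
  have key : ∀ x : K, x ^ 2 + u * x + v = 0 → r ≠ x ∧ x ^ 3 + a * x ^ 2 + b * x + c = 0 := by
    refine fun x hx => ⟨fun h => hm0 (by rw [hm, h, hx]), ?_⟩
    rw [hv, hu] at hx
    linear_combination (x - r) * hx + hr
  have hroot : ∀ e : K, e ^ 2 = u ^ 2 - 4 * v → ((-u + e) / 2) ^ 2 + u * ((-u + e) / 2) + v = 0 := by
    intro e he
    field_simp
    linear_combination he
  obtain ⟨k1, k2⟩ := key _ (hroot w hww)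
  obtain ⟨k3, k4⟩ := key _ (hroot (-w) (by rw [neg_sq, hww]))
  refine ⟨_, _, k1, k3, fun h => ?_, k2, k4⟩
  field_simp at h
  exact mul_ne_zero h2 hw0 (by linear_combination h)

lemma cubic_coeffs_of_two_roots {K : Type} [Field K] {a b c r s : K} (hrs : r ≠ s)
    (hr : r ^ 3 + a * r ^ 2 + b * r + c = 0) (hs : s ^ 3 + a * s ^ 2 + b * s + c = 0) :
    b = r * s + (r + s) * (-a - r - s) ∧ c = - (r * s * (-a - r - s)) := by
  have h1 : r ^ 2 + r * s + s ^ 2 + a * (r + s) + b = 0 := by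
    refine mul_left_cancel₀ (sub_ne_zero.mpr hrs) ?_
    linear_combination hr - hs
  refine ⟨by linear_combination h1, by linear_combination hr - r * h1⟩

lemma card_roots_pencil_le (h2 : (2 : F) ≠ 0) {a b c α β γ δ : F} (hD : cubicDisc a b c ≠ 0)
    (hQ : ∀ x, γ + δ * x = 0 → (α + β * x) ^ 2 ≠ x ^ 3 + a * x ^ 2 + b * x + c) {t : F}
    (hno : ¬ ∃ x₁ x₂ x₃ : F, x₁ ≠ x₂ ∧ x₁ ≠ x₃ ∧ x₂ ≠ x₃ ∧ ∀ x, x = x₁ ∨ x = x₂ ∨ x = x₃ →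
      ((α + γ * t) + (β + δ * t) * x) ^ 2 = x ^ 3 + a * x ^ 2 + b * x + c) :
    (Finset.univ.filter fun x =>
      ((α + γ * t) + (β + δ * t) * x) ^ 2 = x ^ 3 + a * x ^ 2 + b * x + c).card ≤
      (if ¬ IsSquare ((pencilDisc a b c α β γ δ).eval t) then 1 else 0) +
      (if (pencilDisc a b c α β γ δ).eval t = 0 ∧
        (derivative (pencilDisc a b c α β γ δ)).eval t ≠ 0 then 1 else 0) +
      (if (pencilDisc a b c α β γ δ).eval t = 0 then 1 else 0) := by
  set N := Finset.univ.filter fun x =>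
    ((α + γ * t) + (β + δ * t) * x) ^ 2 = x ^ 3 + a * x ^ 2 + b * x + c with hN
  set A := a - (β + δ * t) ^ 2 with hA
  set B := b - 2 * (α + γ * t) * (β + δ * t) with hB
  set E := c - (α + γ * t) ^ 2 with hE
  have hmem : ∀ x, ((α + γ * t) + (β + δ * t) * x) ^ 2 = x ^ 3 + a * x ^ 2 + b * x + c ↔
      x ^ 3 + A * x ^ 2 + B * x + E = 0 := by
    intro x
    rw [hA, hB, hE]
    constructor <;> intro h <;> linear_combination -h
  have hNm : ∀ x, x ∈ N ↔ x ^ 3 + A * x ^ 2 + B * x + E = 0 := fun x => by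
    rw [hN, Finset.mem_filter, hmem]; simp
  have hno' : ∀ x₁ x₂ x₃, x₁ ≠ x₂ → x₁ ≠ x₃ → x₂ ≠ x₃ → x₁ ^ 3 + A * x₁ ^ 2 + B * x₁ + E = 0 →
      x₂ ^ 3 + A * x₂ ^ 2 + B * x₂ + E = 0 → x₃ ^ 3 + A * x₃ ^ 2 + B * x₃ + E = 0 → False := by
    intro x₁ x₂ x₃ h12 h13 h23 e1 e2 e3
    refine hno ⟨x₁, x₂, x₃, h12, h13, h23, ?_⟩
    rintro x (rfl | rfl | rfl) <;> rwa [hmem]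
  have hdisc : (pencilDisc a b c α β γ δ).eval t = cubicDisc A B E := eval_pencilDisc ..
  have hdouble : ∀ r s, r ≠ s → A = -(2 * r + s) → B = r ^ 2 + 2 * r * s → E = -(r ^ 2 * s) →
      (pencilDisc a b c α β γ δ).eval t = 0 ∧
        (derivative (pencilDisc a b c α β γ δ)).eval t ≠ 0 := by
    intro r s hrs h1 h3 h4
    refine ⟨by rw [hdisc, h1, h3, h4, cubicDisc]; ring, ?_⟩
    rw [eval_derivative_pencilDisc h1 h3 h4]
    have hr : ((α + γ * t) + (β + δ * t) * r) ^ 2 = r ^ 3 + a * r ^ 2 + b * r + c := by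
      rw [hmem, h1, h3, h4]; ring
    refine mul_ne_zero (mul_ne_zero (mul_ne_zero ?_ (pow_ne_zero 3 (sub_ne_zero.mpr hrs))) ?_) ?_
    · rw [show (8 : F) = 2 ^ 3 by norm_num]; exact pow_ne_zero 3 h2
    · intro hl
      rw [hl, zero_pow two_ne_zero] at hr
      refine deriv_ne_zero_of_cubicDisc_ne_zero hD hr.symm ?_
      linear_combination 2 * r * h1 + h3 + 2 * r * hA + hB + 2 * (β + δ * t) * hl
    · intro hw
      refine hQ r hw ?_
      rw [← hr]
      linear_combination -t * (2 * α + 2 * β * r + t * (γ + δ * r)) * hw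
  have hle : N.card ≤ 2 := by
    by_contra! h
    obtain ⟨x₁, m1, x₂, m2, x₃, m3, h12, h13, h23⟩ := Finset.two_lt_card.mp h
    exact hno' x₁ x₂ x₃ h12 h13 h23 ((hNm _).mp m1) ((hNm _).mp m2) ((hNm _).mp m3)
  rcases (by omega : N.card = 0 ∨ N.card = 1 ∨ 1 < N.card) with h | h | h
  · omega
  · by_cases hs : IsSquare ((pencilDisc a b c α β γ δ).eval t)
    · by_cases h0 : (pencilDisc a b c α β γ δ).eval t = 0
      · rw [if_pos h0]; omega
      · exfalso
        obtain ⟨r, hr⟩ := Finset.card_pos.mp (by omega : 0 < N.card)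
        rw [hdisc] at hs h0
        obtain ⟨s, z, h1, h3, h4, h5, h6⟩ :=
          exists_roots_of_isSquare_cubicDisc h2 ((hNm r).mp hr) h0 hs
        exact hno' r s z h1 h3 h4 ((hNm r).mp hr) h5 h6
    · rw [if_pos hs]; omega
  · obtain ⟨r, hr, s, hs, hrs⟩ := Finset.one_lt_card.mp h
    rw [hNm] at hr hs
    obtain ⟨hB', hE'⟩ := cubic_coeffs_of_two_roots hrs hr hs
    have hz : (-A - r - s) ^ 3 + A * (-A - r - s) ^ 2 + B * (-A - r - s) + E = 0 := by
      rw [hB', hE']; ring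
    have : (pencilDisc a b c α β γ δ).eval t = 0 ∧
        (derivative (pencilDisc a b c α β γ δ)).eval t ≠ 0 := by
      by_cases h1 : r = -A - r - s
      · have hA' : A = -(2 * r + s) := by linear_combination h1
        refine hdouble r s hrs hA' ?_ ?_
        · rw [hB', ← h1]; ring
        · rw [hE', ← h1]; ring
      · by_cases h3 : s = -A - r - s
        · have hA' : A = -(2 * s + r) := by linear_combination h3
          refine hdouble s r hrs.symm hA' ?_ ?_
          · rw [hB', ← h3]; ring
          · rw [hE', ← h3]; ring
        · exact (hno' r s _ hrs h1 h3 hr hs hz).elim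
    rw [if_pos this, if_pos this.1]
    omega

lemma card_filter_sq_eq_le (v : F) : (Finset.univ.filter fun y : F => y ^ 2 = v).card ≤ 2 := by
  by_contra! h
  obtain ⟨x, hx, y, hy, z, hz, hxy, hxz, hyz⟩ := Finset.two_lt_card.mp h
  simp only [Finset.mem_filter, Finset.mem_univ, true_and] at hx hy hz
  have h1 : y = -x := ((sq_eq_sq_iff_eq_or_eq_neg.mp (hy.trans hx.symm)).resolve_left hxy.symm)
  have h3 : z = -x := ((sq_eq_sq_iff_eq_or_eq_neg.mp (hz.trans hx.symm)).resolve_left hxz.symm)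
  exact hyz (h1.trans h3.symm)

/-- A pencil of lines whose discriminant is not a square up to constants contains a line with
three distinct rational affine intersections. -/
lemma exists_three_secant_of_nonSq (hq : 121 ≤ Fintype.card F) (hodd : Odd (Fintype.card F))
    {a b c α β γ δ : F} (hD : cubicDisc a b c ≠ 0) (hγδ : γ ≠ 0 ∨ δ ≠ 0)
    (hQ : ∀ x, γ + δ * x = 0 → (α + β * x) ^ 2 ≠ x ^ 3 + a * x ^ 2 + b * x + c)
    (hdeg : (pencilDisc a b c α β γ δ).natDegree ≤ 6) (hns : NonSq (pencilDisc a b c α β γ δ)) :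
    ∃ t x₁ x₂ x₃ : F, x₁ ≠ x₂ ∧ x₁ ≠ x₃ ∧ x₂ ≠ x₃ ∧ ∀ x, x = x₁ ∨ x = x₂ ∨ x = x₃ →
      ((α + γ * t) + (β + δ * t) * x) ^ 2 = x ^ 3 + a * x ^ 2 + b * x + c := by
  have h2 : (2 : F) ≠ 0 := Ring.two_ne_zero fun h => by
    have := FiniteField.even_card_iff_char_two.mp h
    have := Nat.odd_iff.mp hodd
    omega
  by_contra hno
  set D := pencilDisc a b c α β γ δ with hDdef
  have hle := le_card_affPoints hq hodd hD
  have hS := stepanov_bound hodd hns 1 5 53 6 0 (by omega) (by omega) (by omega) (by omega)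
    (by omega) (by norm_num [chainConds])
  have hroots : (Finset.univ.filter fun t => D.eval t = 0).card ≤ 6 := by
    have : (Finset.univ.filter fun t => D.eval t = 0) ⊆ D.roots.toFinset := fun t ht => by
      simpa [hns.ne_zero] using ht
    exact (Finset.card_le_card this).trans ((Multiset.toFinset_card_le _).trans
      ((card_roots' D).trans hdeg))
  have hsub : (Finset.univ.filter fun t => D.eval t = 0 ∧ (derivative D).eval t ≠ 0).card ≤
      (Finset.univ.filter fun t => D.eval t = 0).card :=
    Finset.card_le_card fun t ht => by simp only [Finset.mem_filter] at ht ⊢; exact ⟨ht.1, ht.2.1⟩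
  have hvert : ((affPoints a b c).filter fun p => γ + δ * p.1 = 0).card ≤ 2 := by
    by_cases hδ : δ = 0
    · rw [Finset.card_eq_zero.mpr]
      · omega
      · refine Finset.filter_eq_empty_iff.mpr fun p _ h => ?_
        rw [hδ, zero_mul, add_zero] at h
        exact hγδ.elim (· h) (· hδ)
    · have hx : ∀ x, γ + δ * x = 0 → x = -γ / δ := fun x h => by
        field_simp; linear_combination h
      refine le_trans ?_ (card_filter_sq_eq_le
        ((-γ / δ) ^ 3 + a * (-γ / δ) ^ 2 + b * (-γ / δ) + c))
      refine Finset.card_le_card_of_injOn Prod.snd (fun p hp => ?_) fun p hp r hr h => ?_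
      · simp only [Finset.coe_filter, affPoints, Finset.mem_filter, Set.mem_ofPred_eq,
          Finset.mem_univ, true_and] at hp ⊢
        rw [hp.1, hx _ hp.2]
      · simp only [Finset.coe_filter, Set.mem_ofPred_eq] at hp hr
        exact Prod.ext ((hx _ hp.2).trans (hx _ hr.2).symm) h
  have hrest : ((affPoints a b c).filter fun p => ¬ γ + δ * p.1 = 0).card ≤
      ∑ t : F, (Finset.univ.filter fun x =>
        ((α + γ * t) + (β + δ * t) * x) ^ 2 = x ^ 3 + a * x ^ 2 + b * x + c).card := by
    rw [← Finset.card_sigma]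
    refine Finset.card_le_card_of_injOn
      (fun p => ⟨(p.2 - α - β * p.1) / (γ + δ * p.1), p.1⟩) (fun p hp => ?_) fun p hp r hr h => ?_
    · simp only [Finset.coe_filter, affPoints, Finset.mem_filter, Set.mem_ofPred_eq,
          Finset.mem_univ, true_and] at hp
      simp only [Finset.coe_sigma, Finset.coe_univ, Set.mem_sigma_iff, Set.mem_univ, true_and,
        Finset.coe_filter, Finset.mem_univ, Set.mem_ofPred_eq]
      rw [← hp.1]
      congr 1
      linear_combination div_mul_cancel₀ (p.2 - α - β * p.1) hp.2
    · simp only [Finset.coe_filter, Set.mem_ofPred_eq] at hp hr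
      simp only [Sigma.mk.injEq, heq_eq_eq] at h
      obtain ⟨h1, h3⟩ := h
      refine Prod.ext h3 ?_
      rw [h3, div_left_inj' hr.2] at h1
      linear_combination h1
  have hsum := hrest.trans (Finset.sum_le_sum fun t _ => card_roots_pencil_le h2 hD hQ (t := t)
    fun h => hno ⟨t, h⟩)
  rw [Finset.sum_add_distrib, Finset.sum_add_distrib, ← Finset.sum_filter, ← Finset.sum_filter,
    ← Finset.sum_filter, Finset.sum_const, Finset.sum_const, Finset.sum_const] at hsum
  simp only [smul_eq_mul, mul_one, ← hDdef] at hsum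
  have hsplit := Finset.card_filter_add_card_filter_not (s := affPoints a b c)
    (fun p => γ + δ * p.1 = 0)
  rcases hq.eq_or_lt with h121 | h121
  · rw [← h121] at hS hle
    have : (Finset.univ.filter fun t => ¬ IsSquare (D.eval t)).card +
      (Finset.univ.filter fun t => D.eval t = 0 ∧ (derivative D).eval t ≠ 0).card ≤ 88 := by omega
    omega
  · omega

end Pencil

section NonSquare

open Polynomial

lemma NonSq.of_map {K L : Type} [Field K] [Field L] (φ : K →+* L) {H : K[X]}
    (h : NonSq (H.map φ)) : NonSq H := fun κ hκ S hS =>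
  h (φ κ) ((map_ne_zero φ).mpr hκ) (S.map φ) (by
    rw [← Polynomial.map_pow, ← hS, Polynomial.map_mul, map_C])

lemma pencilDisc_map {K L : Type} [Field K] [Field L] (φ : K →+* L) (a b c α β γ δ : K) :
    (pencilDisc a b c α β γ δ).map φ =
      pencilDisc (φ a) (φ b) (φ c) (φ α) (φ β) (φ γ) (φ δ) := by
  simp [pencilDisc, cubicDisc]

variable {K : Type} [Field K]

lemma coeffs_eq_zero_of_sq_dvd {t A B : K} {M : K[X]}
    (h : (X - C t) ^ 2 ∣ C A + C B * (X - C t) + M * (X - C t) ^ 2) : A = 0 ∧ B = 0 := by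
  obtain ⟨G, hG⟩ := h
  have hA : A = 0 := by simpa using congrArg (eval t) hG
  refine ⟨hA, ?_⟩
  rw [hA] at hG
  have : C B + M * (X - C t) = (X - C t) * G := by
    refine mul_left_cancel₀ (X_sub_C_ne_zero t) ?_
    linear_combination hG + (by simp : (C (0 : K)) = 0) * (-1)
  simpa using congrArg (eval t) this

lemma natDegree_even_of_eq_sq {κ : K} (hκ : κ ≠ 0) {D S : K[X]} (h : C κ * D = S ^ 2) :
    D.natDegree = 2 * S.natDegree := by
  have := congrArg natDegree h
  rwa [natDegree_C_mul hκ, natDegree_pow] at this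

lemma sq_dvd_of_eq_sq {κ : K} (hκ : κ ≠ 0) {D S G : K[X]} (h : C κ * D = S ^ 2) (hG : G ∣ S) :
    G ^ 2 ∣ D := by
  have h1 : G ^ 2 ∣ C κ * D := h ▸ pow_dvd_pow_of_dvd hG 2
  have h2 : D = C κ⁻¹ * (C κ * D) := by
    rw [← mul_assoc, ← C_mul, inv_mul_cancel₀ hκ, C_1, one_mul]
  rw [h2]
  exact h1.mul_left _

lemma eval_eq_zero_of_sq_dvd {D : K[X]} {t : K} (h : (X - C t) ^ 2 ∣ D) :
    D.eval t = 0 ∧ (derivative D).eval t = 0 := by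
  obtain ⟨G, rfl⟩ := h
  simp [derivative_pow]

lemma exists_roots_of_natDegree_eq_three [IsAlgClosed K] {S : K[X]} (h : S.natDegree = 3) :
    ∃ x y z, S = C S.leadingCoeff * ((X - C x) * (X - C y) * (X - C z)) := by
  have hs := IsAlgClosed.splits S
  obtain ⟨x, y, z, hxyz⟩ := Multiset.card_eq_three.mp (hs.natDegree_eq_card_roots.symm.trans h)
  have := hs.eq_prod_roots
  refine ⟨x, y, z, ?_⟩
  rw [hxyz] at this
  simpa [mul_assoc] using this

lemma exists_roots_of_natDegree_eq_two [IsAlgClosed K] {S : K[X]} (h : S.natDegree = 2) :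
    ∃ x y, S = C S.leadingCoeff * ((X - C x) * (X - C y)) := by
  have hs := IsAlgClosed.splits S
  obtain ⟨x, y, hxyz⟩ := Multiset.card_eq_two.mp (hs.natDegree_eq_card_roots.symm.trans h)
  have := hs.eq_prod_roots
  refine ⟨x, y, ?_⟩
  rw [hxyz] at this
  simpa [mul_assoc] using this

lemma exists_double_root_of_cubicDisc_eq_zero [IsAlgClosed K] {a b c : K}
    (h : cubicDisc a b c = 0) :
    ∃ r s, a = -(2 * r + s) ∧ b = r ^ 2 + 2 * r * s ∧ c = -(r ^ 2 * s) := by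
  let S : K[X] := X ^ 3 + C a * X ^ 2 + C b * X + C c
  have hdeg : S.natDegree = 3 := by simp only [S]; compute_degree!
  have hmon : S.leadingCoeff = 1 := by rw [leadingCoeff, hdeg]; simp [S]
  obtain ⟨x, y, z, hS⟩ := exists_roots_of_natDegree_eq_three hdeg
  rw [hmon, C_1, one_mul] at hS
  have hexp : S = X ^ 3 + C (-(x + y + z)) * X ^ 2 + C (x * y + x * z + y * z) * X +
      C (-(x * y * z)) := by
    rw [hS]; simp only [map_neg, map_add, map_mul]; ring
  generalize he2 : -(x + y + z) = e₂ at hexp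
  generalize he1 : x * y + x * z + y * z = e₁ at hexp
  generalize he0 : -(x * y * z) = e₀ at hexp
  have h2 : a = -(x + y + z) := by
    rw [he2]; simpa [S, coeff_X, coeff_C] using congrArg (coeff · 2) hexp
  have h1 : b = x * y + x * z + y * z := by
    rw [he1]; simpa [S, coeff_X, coeff_C] using congrArg (coeff · 1) hexp
  have h0 : c = -(x * y * z) := by
    rw [he0]; simpa [S, coeff_X, coeff_C] using congrArg (coeff · 0) hexp
  have hd : ((x - y) * (x - z) * (y - z)) ^ 2 = 0 := by
    rw [← h, h2, h1, h0, cubicDisc]; ring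
  rcases mul_eq_zero.mp (pow_eq_zero_iff two_ne_zero |>.mp hd) with h3 | h3
  · rcases mul_eq_zero.mp h3 with h4 | h4
    · rw [sub_eq_zero] at h4; subst h4
      exact ⟨x, z, by rw [h2]; ring, by rw [h1]; ring, by rw [h0]; ring⟩
    · rw [sub_eq_zero] at h4; subst h4
      exact ⟨x, y, by rw [h2]; ring, by rw [h1]; ring, by rw [h0]; ring⟩
  · rw [sub_eq_zero] at h3; subst h3
    exact ⟨y, x, by rw [h2]; ring, by rw [h1]; ring, by rw [h0]; ring⟩

/-- A line of the pencil at which the discriminant vanishes doubly is an inflexional tangent. -/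
lemma exists_triple_root_of_pencilDisc [IsAlgClosed K] (h2 : (2 : K) ≠ 0) {a b c α β γ δ t : K}
    (hD : cubicDisc a b c ≠ 0)
    (hQ : ∀ x, γ + δ * x = 0 → (α + β * x) ^ 2 ≠ x ^ 3 + a * x ^ 2 + b * x + c)
    (h : (pencilDisc a b c α β γ δ).eval t = 0)
    (h' : (derivative (pencilDisc a b c α β γ δ)).eval t = 0) :
    ∃ r, a = (β + δ * t) ^ 2 - 3 * r ∧ b = 2 * (α + γ * t) * (β + δ * t) + 3 * r ^ 2 ∧
      c = (α + γ * t) ^ 2 - r ^ 3 ∧ (α + γ * t) + (β + δ * t) * r ≠ 0 := by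
  rw [eval_pencilDisc] at h
  obtain ⟨r, s, e2, e1, e0⟩ := exists_double_root_of_cubicDisc_eq_zero h
  rw [eval_derivative_pencilDisc e2 e1 e0] at h'
  have hr : ((α + γ * t) + (β + δ * t) * r) ^ 2 = r ^ 3 + a * r ^ 2 + b * r + c := by
    linear_combination - r ^ 2 * e2 - r * e1 - e0
  have hl : (α + γ * t) + (β + δ * t) * r ≠ 0 := fun hl => by
    rw [hl, zero_pow two_ne_zero] at hr
    refine deriv_ne_zero_of_cubicDisc_ne_zero hD hr.symm ?_
    linear_combination 2 * r * e2 + e1 + 2 * (β + δ * t) * hl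
  have hw : γ + δ * r ≠ 0 := fun hw => hQ r hw (by
    rw [← hr]
    linear_combination -t * (2 * α + 2 * β * r + t * (γ + δ * r)) * hw)
  have hrs : s = r := by
    by_contra hne
    refine mul_ne_zero (mul_ne_zero (mul_ne_zero ?_
      (pow_ne_zero 3 (sub_ne_zero.mpr (Ne.symm hne)))) hl) hw h'
    rw [show (8 : K) = 2 ^ 3 by norm_num]; exact pow_ne_zero 3 h2
  subst hrs
  exact ⟨s, by linear_combination e2, by linear_combination e1, by linear_combination e0, hl⟩

/-- Coefficients of the discriminant of the pencil of lines through `(0, α)`. -/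
lemma pencilDisc_point_eq (a b c α : K) : pencilDisc a b c α 0 0 1 =
    C (4 * c) * X ^ 6 + C (-4 * α * b) * X ^ 5 +
      C (b ^ 2 - 8 * a * α ^ 2 - 12 * a * (c - α ^ 2)) * X ^ 4 +
      C (8 * a * α * b + 32 * α ^ 3 + 36 * α * (c - α ^ 2)) * X ^ 3 +
      C (-2 * a * b ^ 2 + 4 * a ^ 2 * α ^ 2 - 48 * α ^ 2 * b + 12 * a ^ 2 * (c - α ^ 2)
        - 18 * b * (c - α ^ 2)) * X ^ 2 +
      C (-4 * a ^ 2 * α * b + 24 * α * b ^ 2 - 36 * α * a * (c - α ^ 2)) * X +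
      C (cubicDisc a b (c - α ^ 2)) := by
  simp only [pencilDisc, cubicDisc, map_add, map_sub, map_mul, map_neg, map_pow, map_ofNat, map_zero,
    map_one]
  ring

/-- Taylor expansion of the discriminant at an inflexional tangent through `(0, y - tr)`. -/
lemma pencilDisc_point_expansion (t r y : K) :
    pencilDisc (t ^ 2 - 3 * r) (2 * (y - t * r) * t + 3 * r ^ 2) ((y - t * r) ^ 2 - r ^ 3)
      (y - t * r) 0 0 1 =
    (X - C t) ^ 2 * (C (-108 * r ^ 2 * y ^ 2) + C (32 * y ^ 3 - 48 * r * t * y ^ 2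
        - 48 * r ^ 2 * t ^ 2 * y + 32 * r ^ 3 * t ^ 3 - 108 * r ^ 3 * y) * (X - C t) +
      (C (16 * t ^ 2 * y ^ 2 - 32 * r * t ^ 3 * y + 24 * r * y ^ 2 - 96 * r ^ 2 * t * y
          + 16 * r ^ 2 * t ^ 4 + 24 * r ^ 3 * t ^ 2 - 27 * r ^ 4) +
        C (16 * t * y ^ 2 - 32 * r * t ^ 2 * y + 16 * r ^ 2 * t ^ 3 - 12 * r ^ 2 * y
          - 12 * r ^ 3 * t) * (X - C t) +
        C (4 * (y - r * t) ^ 2 - 4 * r ^ 3) * (X - C t) ^ 2) * (X - C t) ^ 2) := by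
  simp only [pencilDisc, cubicDisc, map_add, map_sub, map_mul, map_neg, map_pow, map_ofNat, map_zero,
    map_one]
  ring

/-- The discriminant of the pencil of lines through an affine point off the curve. -/
lemma nonSq_pencilDisc_point [IsAlgClosed K] (h2 : (2 : K) ≠ 0) {a b c α : K}
    (hD : cubicDisc a b c ≠ 0) (hj : a ^ 2 - 3 * b ≠ 0) (hα : α ^ 2 ≠ c) :
    NonSq (pencilDisc a b c α 0 0 1) := by
  intro κ hκ S hS
  have hdeg := natDegree_even_of_eq_sq hκ hS
  have h4 : (4 : K) ≠ 0 := by rw [show (4 : K) = 2 ^ 2 by norm_num]; exact pow_ne_zero 2 h2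
  have hQ : ∀ x : K, 0 + 1 * x = 0 → (α + 0 * x) ^ 2 ≠ x ^ 3 + a * x ^ 2 + b * x + c := by
    intro x hx
    rw [zero_add, one_mul] at hx
    subst hx
    simpa using hα
  by_cases hc : c = 0
  · have hα0 : α ≠ 0 := fun h => hα (by rw [h, hc]; simp)
    have hb : b ≠ 0 := fun h => hD (by rw [h, hc, cubicDisc]; ring)
    have h5 : -4 * α * b ≠ 0 := mul_ne_zero (mul_ne_zero (neg_ne_zero.mpr h4) hα0) hb
    have : (pencilDisc a b c α 0 0 1).natDegree = 5 := by
      rw [pencilDisc_point_eq, hc, mul_zero, C_0, zero_mul, zero_add]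
      compute_degree!
    omega
  have h6 : (pencilDisc a b c α 0 0 1).natDegree = 6 := by
    rw [pencilDisc_point_eq]
    have : 4 * c ≠ 0 := mul_ne_zero h4 hc
    compute_degree!
  obtain ⟨τ₁, τ₂, τ₃, hfac⟩ := exists_roots_of_natDegree_eq_three (S := S) (by omega)
  have hdvd1 : ∀ τ, X - C τ ∣ S → ∃ r, a = τ ^ 2 - 3 * r ∧ b = 2 * α * τ + 3 * r ^ 2 ∧
      c = α ^ 2 - r ^ 3 ∧ α + τ * r ≠ 0 ∧ r ≠ 0 := by
    intro τ hτ
    obtain ⟨h0, h0'⟩ := eval_eq_zero_of_sq_dvd (sq_dvd_of_eq_sq hκ hS hτ)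
    obtain ⟨r, e1, e3, e5, e7⟩ := exists_triple_root_of_pencilDisc h2 hD hQ h0 h0'
    refine ⟨r, by linear_combination e1, by linear_combination e3, by linear_combination e5,
      fun h => e7 (by linear_combination h), fun h => hα ?_⟩
    rw [h] at e5; linear_combination -e5
  have hdvd2 : ∀ τ r, (X - C τ) ^ 2 ∣ S → a = τ ^ 2 - 3 * r → b = 2 * α * τ + 3 * r ^ 2 →
      c = α ^ 2 - r ^ 3 → -108 * r ^ 2 * (α + τ * r) ^ 2 = 0 ∧
        32 * (α + τ * r) ^ 3 - 48 * r * τ * (α + τ * r) ^ 2 - 48 * r ^ 2 * τ ^ 2 * (α + τ * r)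
          + 32 * r ^ 3 * τ ^ 3 - 108 * r ^ 3 * (α + τ * r) = 0 := by
    intro τ r hτ ea eb ec
    have h := sq_dvd_of_eq_sq hκ hS hτ
    obtain ⟨y, hy⟩ : ∃ y, y = α + τ * r := ⟨_, rfl⟩
    have hαy : α = y - τ * r := by rw [hy]; ring
    rw [← hy]
    rw [ea, eb, ec, hαy, pencilDisc_point_expansion, ← pow_mul, pow_add _ 2 2,
      mul_dvd_mul_iff_left (pow_ne_zero 2 (X_sub_C_ne_zero τ))] at h
    exact coeffs_eq_zero_of_sq_dvd h
  have hτ₁ : X - C τ₁ ∣ S := ⟨C S.leadingCoeff * ((X - C τ₂) * (X - C τ₃)), by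
    conv_lhs => rw [hfac]
    ring⟩
  have hτ₂ : X - C τ₂ ∣ S := ⟨C S.leadingCoeff * ((X - C τ₁) * (X - C τ₃)), by
    conv_lhs => rw [hfac]
    ring⟩
  have hτ₃ : X - C τ₃ ∣ S := ⟨C S.leadingCoeff * ((X - C τ₁) * (X - C τ₂)), by
    conv_lhs => rw [hfac]
    ring⟩
  have h12 : τ₁ = τ₂ → (X - C τ₁) ^ 2 ∣ S := fun h => ⟨C S.leadingCoeff * (X - C τ₃), by
    conv_lhs => rw [hfac, ← h]
    ring⟩
  have h13 : τ₁ = τ₃ → (X - C τ₁) ^ 2 ∣ S := fun h => ⟨C S.leadingCoeff * (X - C τ₂), by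
    conv_lhs => rw [hfac, ← h]
    ring⟩
  have h23 : τ₂ = τ₃ → (X - C τ₂) ^ 2 ∣ S := fun h => ⟨C S.leadingCoeff * (X - C τ₁), by
    conv_lhs => rw [hfac, ← h]
    ring⟩
  obtain ⟨r₁, a1, b1, c1, y1, z1⟩ := hdvd1 τ₁ hτ₁
  obtain ⟨r₂, a2, b2, c2, y2, z2⟩ := hdvd1 τ₂ hτ₂
  obtain ⟨r₃, a3, b3, c3, y3, z3⟩ := hdvd1 τ₃ hτ₃
  by_cases hthree : (3 : K) = 0
  · have ha : a ≠ 0 := fun h => hj (by rw [h, hthree]; ring)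
    have key : ∀ τ r, (X - C τ) ^ 2 ∣ S → a = τ ^ 2 - 3 * r → b = 2 * α * τ + 3 * r ^ 2 →
        c = α ^ 2 - r ^ 3 → r ≠ 0 → α = r * τ ∧ α ≠ 0 := by
      intro τ r hτ ea eb ec hr
      have h := (hdvd2 τ r hτ ea eb ec).2
      have h1 : (α + τ * r + r * τ) ^ 3 = 0 := by
        linear_combination (11 * (α + τ * r) ^ 3 - 15 * r * τ * (α + τ * r) ^ 2
          - 15 * r ^ 2 * τ ^ 2 * (α + τ * r) + 11 * r ^ 3 * τ ^ 3
          - 36 * r ^ 3 * (α + τ * r)) * hthree - h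
      have h1' := (pow_eq_zero_iff three_ne_zero).mp h1
      have h3 : α = r * τ := by linear_combination h1' - r * τ * hthree
      refine ⟨h3, fun h0 => ha ?_⟩
      have hτ0 : τ = 0 := (mul_eq_zero.mp (h3.symm.trans h0)).resolve_left hr
      rw [ea, hτ0, hthree]; ring
    have hex : α ≠ 0 := by
      by_cases e12 : τ₁ = τ₂
      · exact (key τ₁ r₁ (h12 e12) a1 b1 c1 z1).2
      by_cases e13 : τ₁ = τ₃
      · exact (key τ₁ r₁ (h13 e13) a1 b1 c1 z1).2
      have m2 : τ₂ = -τ₁ := (sq_eq_sq_iff_eq_or_eq_neg.mp (by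
        linear_combination a1 - a2 - (r₁ - r₂) * hthree)).resolve_left (Ne.symm e12)
      have m3 : τ₃ = -τ₁ := (sq_eq_sq_iff_eq_or_eq_neg.mp (by
        linear_combination a1 - a3 - (r₁ - r₃) * hthree)).resolve_left (Ne.symm e13)
      exact (key τ₂ r₂ (h23 (m2.trans m3.symm)) a2 b2 c2 z2).2
    have e12 : τ₂ = τ₁ := mul_left_cancel₀ (mul_ne_zero h2 hex) (by
      linear_combination b1 - b2 + (r₁ ^ 2 - r₂ ^ 2) * hthree)
    have e13 : τ₃ = τ₁ := mul_left_cancel₀ (mul_ne_zero h2 hex) (by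
      linear_combination b1 - b3 + (r₁ ^ 2 - r₃ ^ 2) * hthree)
    have h3 := (key τ₁ r₁ (h12 e12.symm) a1 b1 c1 z1).1
    have hcube : (X - C τ₁) ^ 3 ∣ S := ⟨C S.leadingCoeff, by
      conv_lhs => rw [hfac, e12, e13]
      ring⟩
    have h := sq_dvd_of_eq_sq hκ hS hcube
    obtain ⟨y, hy⟩ : ∃ y, y = α + τ₁ * r₁ := ⟨_, rfl⟩
    have hαy : α = y - τ₁ * r₁ := by rw [hy]; ring
    obtain ⟨q2, q3⟩ := hdvd2 τ₁ r₁ (h12 e12.symm) a1 b1 c1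
    rw [← hy] at q2 q3
    rw [a1, b1, c1, hαy, pencilDisc_point_expansion, q2, q3, C_0, zero_mul, zero_add, zero_add,
      mul_comm _ ((X - C τ₁) ^ 2), ← pow_mul, show 3 * 2 = 2 + (2 + 2) by norm_num,
      pow_add _ 2 (2 + 2), pow_add _ 2 2, mul_dvd_mul_iff_left (pow_ne_zero 2 (X_sub_C_ne_zero τ₁)),
      mul_dvd_mul_iff_left (pow_ne_zero 2 (X_sub_C_ne_zero τ₁))] at h
    have h5 := (coeffs_eq_zero_of_sq_dvd h).1
    have h7 : (τ₁ * α) ^ 2 = 0 := by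
      rw [hαy]
      linear_combination h5 - (5 * τ₁ ^ 2 * y ^ 2 - 10 * r₁ * τ₁ ^ 3 * y + 8 * r₁ * y ^ 2
        - 32 * r₁ ^ 2 * τ₁ * y + 5 * r₁ ^ 2 * τ₁ ^ 4 + 8 * r₁ ^ 3 * τ₁ ^ 2 - 9 * r₁ ^ 4) * hthree
    have hτ0 : τ₁ = 0 :=
      (mul_eq_zero.mp (pow_eq_zero_iff two_ne_zero |>.mp h7)).resolve_right hex
    exact ha (by rw [a1, hτ0, hthree]; ring)
  · have h108 : (-108 : K) ≠ 0 := by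
      rw [show (-108 : K) = -(2 ^ 2 * 3 ^ 3) by norm_num]
      exact neg_ne_zero.mpr (mul_ne_zero (pow_ne_zero 2 h2) (pow_ne_zero 3 hthree))
    have hnd : ∀ τ r, (X - C τ) ^ 2 ∣ S → a = τ ^ 2 - 3 * r → b = 2 * α * τ + 3 * r ^ 2 →
      c = α ^ 2 - r ^ 3 → α + τ * r ≠ 0 → r ≠ 0 → False := fun τ r hτ ea eb ec hy hr =>
      mul_ne_zero (mul_ne_zero h108 (pow_ne_zero 2 hr)) (pow_ne_zero 2 hy) (hdvd2 τ r hτ ea eb ec).1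
    have n12 : τ₁ ≠ τ₂ := fun h => hnd τ₁ r₁ (h12 h) a1 b1 c1 y1 z1
    have n13 : τ₁ ≠ τ₃ := fun h => hnd τ₁ r₁ (h13 h) a1 b1 c1 y1 z1
    have n23 : τ₂ ≠ τ₃ := fun h => hnd τ₂ r₂ (h23 h) a2 b2 c2 y2 z2
    by_cases hα0 : α = 0
    · have hr : ∀ r s, r ≠ 0 → s ≠ 0 → b = 2 * α * τ₁ + 3 * r ^ 2 → r ^ 3 = s ^ 3 → b = 3 * s ^ 2 →
          r = s := by
        intro r s hr hs e1 e2 e3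
        have : r ^ 2 = s ^ 2 := mul_left_cancel₀ hthree (by
          rw [hα0] at e1; linear_combination e3 - e1)
        refine mul_left_cancel₀ (pow_ne_zero 2 hr) ?_
        linear_combination e2 - s * this
      have r12 : r₁ = r₂ := hr r₁ r₂ z1 z2 b1 (by linear_combination c1 - c2)
        (by rw [hα0] at b2; linear_combination b2)
      have r13 : r₁ = r₃ := hr r₁ r₃ z1 z3 b1 (by linear_combination c1 - c3)
        (by rw [hα0] at b3; linear_combination b3)
      have m2 : τ₂ = -τ₁ := (sq_eq_sq_iff_eq_or_eq_neg.mp (by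
        linear_combination a1 - a2 - 3 * r12)).resolve_left n12.symm
      have m3 : τ₃ = -τ₁ := (sq_eq_sq_iff_eq_or_eq_neg.mp (by
        linear_combination a1 - a3 - 3 * r13)).resolve_left n13.symm
      exact n23 (m2.trans m3.symm)
    · have hτr : ∀ τ σ r s, τ ≠ σ → b = 2 * α * τ + 3 * r ^ 2 → b = 2 * α * σ + 3 * s ^ 2 →
          r - s ≠ 0 := fun τ σ r s hne e1 e2 h => hne <|
        mul_left_cancel₀ (mul_ne_zero h2 hα0) (by linear_combination e2 - e1 - 3 * (r + s) * h)
      have d12 := hτr _ _ _ _ n12 b1 b2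
      have d13 := hτr _ _ _ _ n13 b1 b3
      have d23 := hτr _ _ _ _ n23 b2 b3
      have hquad : ∀ τ r, a = τ ^ 2 - 3 * r → b = 2 * α * τ + 3 * r ^ 2 → c = α ^ 2 - r ^ 3 →
          (4 * α ^ 2 * a - b ^ 2) + 6 * b * r ^ 2 + (12 * α ^ 2 - 9 * (α ^ 2 - c)) * r = 0 := by
        intro τ r e1 e2 e3
        linear_combination 4 * α ^ 2 * e1 - (b + 2 * α * τ - 3 * r ^ 2) * e2 + 9 * r * e3
      have p1 := hquad _ _ a1 b1 c1
      have p2 := hquad _ _ a2 b2 c2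
      have p3 := hquad _ _ a3 b3 c3
      have l12 : 6 * b * (r₁ + r₂) + (12 * α ^ 2 - 9 * (α ^ 2 - c)) = 0 :=
        mul_left_cancel₀ d12 (by linear_combination p1 - p2)
      have l13 : 6 * b * (r₁ + r₃) + (12 * α ^ 2 - 9 * (α ^ 2 - c)) = 0 :=
        mul_left_cancel₀ d13 (by linear_combination p1 - p3)
      have hb : 6 * b = 0 := mul_left_cancel₀ d23 (by linear_combination l12 - l13)
      have hb0 : b = 0 := (mul_eq_zero.mp hb).resolve_left (by
        rw [show (6 : K) = 2 * 3 by norm_num]; exact mul_ne_zero h2 hthree)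
      have ha : 4 * α ^ 2 * a = 0 := by
        rw [hb0] at p1 l12; linear_combination p1 - r₁ * l12
      have ha0 : a = 0 := (mul_eq_zero.mp ha).resolve_left (mul_ne_zero h4 (pow_ne_zero 2 hα0))
      exact hj (by rw [ha0, hb0]; ring)

/-- Coefficients of the discriminant of a pencil of parallel lines. -/
lemma pencilDisc_parallel_eq (a b c β : K) : pencilDisc a b c 0 β 1 0 =
    C (-27) * X ^ 4 + C (32 * β ^ 3 + 36 * (a - β ^ 2) * β) * X ^ 3 +
      C (4 * β ^ 2 * (a - β ^ 2) ^ 2 - 48 * b * β ^ 2 + 4 * (a - β ^ 2) ^ 3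
        - 18 * (a - β ^ 2) * b + 54 * c) * X ^ 2 +
      C (-4 * (a - β ^ 2) ^ 2 * b * β + 24 * b ^ 2 * β - 36 * (a - β ^ 2) * β * c) * X +
      C (cubicDisc (a - β ^ 2) b c) := by
  simp only [pencilDisc, cubicDisc, map_add, map_sub, map_mul, map_neg, map_pow, map_ofNat, map_zero,
    map_one]
  ring

/-- Taylor expansion of the discriminant at an inflexional tangent of slope `β`. -/
lemma pencilDisc_parallel_expansion (β t r : K) :
    pencilDisc (β ^ 2 - 3 * r) (2 * t * β + 3 * r ^ 2) (t ^ 2 - r ^ 3) 0 β 1 0 =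
    (X - C t) ^ 2 * (C (-108 * (t + β * r) ^ 2) + C (32 * β ^ 3 - 108 * (r * β + t)) * (X - C t) +
      C (-27) * (X - C t) ^ 2) := by
  simp only [pencilDisc, cubicDisc, map_add, map_sub, map_mul, map_neg, map_pow, map_ofNat, map_zero,
    map_one]
  ring

/-- The discriminant of a pencil of parallel lines. -/
lemma nonSq_pencilDisc_parallel [IsAlgClosed K] (h2 : (2 : K) ≠ 0) {a b c β : K}
    (hD : cubicDisc a b c ≠ 0) (hj : a ^ 2 - 3 * b ≠ 0) :
    NonSq (pencilDisc a b c 0 β 1 0) := by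
  intro κ hκ S hS
  have hdeg := natDegree_even_of_eq_sq hκ hS
  have hQ : ∀ x : K, 1 + 0 * x = 0 → (0 + β * x) ^ 2 ≠ x ^ 3 + a * x ^ 2 + b * x + c := by
    intro x hx
    rw [zero_mul, add_zero] at hx
    exact (one_ne_zero hx).elim
  have hdvd1 : ∀ τ, X - C τ ∣ S → ∃ r, a = β ^ 2 - 3 * r ∧ b = 2 * τ * β + 3 * r ^ 2 ∧
      c = τ ^ 2 - r ^ 3 ∧ τ + β * r ≠ 0 := by
    intro τ hτ
    obtain ⟨h0, h0'⟩ := eval_eq_zero_of_sq_dvd (sq_dvd_of_eq_sq hκ hS hτ)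
    obtain ⟨r, e1, e3, e5, e7⟩ := exists_triple_root_of_pencilDisc h2 hD hQ h0 h0'
    exact ⟨r, by linear_combination e1, by linear_combination e3, by linear_combination e5,
      fun h => e7 (by linear_combination h)⟩
  by_cases hthree : (3 : K) = 0
  · have ha : a ≠ 0 := fun h => hj (by rw [h, hthree]; ring)
    have h27 : (-27 : K) = 0 := by linear_combination -9 * hthree
    by_cases hβ : β = 0
    · have h4 : (pencilDisc a b c 0 β 1 0).natDegree = 2 := by
        have e2 : 4 * β ^ 2 * (a - β ^ 2) ^ 2 - 48 * b * β ^ 2 + 4 * (a - β ^ 2) ^ 3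
            - 18 * (a - β ^ 2) * b + 54 * c ≠ 0 := by
          rw [hβ]
          refine fun h => pow_ne_zero 3 ha ?_
          linear_combination h - (a ^ 3 - 6 * a * b + 18 * c) * hthree
        have e3 : 32 * β ^ 3 + 36 * (a - β ^ 2) * β = 0 := by rw [hβ]; ring
        rw [pencilDisc_parallel_eq, h27, e3, C_0, zero_mul, zero_mul, zero_add, zero_add]
        compute_degree!
      obtain ⟨τ, hτ⟩ := IsAlgClosed.exists_root S
        (by rw [degree_eq_natDegree (by rintro rfl; simp at hdeg; omega)]; norm_cast; omega)
      obtain ⟨r, e1, -⟩ := hdvd1 τ (dvd_iff_isRoot.mpr hτ)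
      exact ha (by rw [e1, hβ, hthree]; ring)
    · have h4 : (pencilDisc a b c 0 β 1 0).natDegree = 3 := by
        have e3 : 32 * β ^ 3 + 36 * (a - β ^ 2) * β ≠ 0 := by
          refine fun h => pow_ne_zero 3 hβ ?_
          linear_combination (11 * β ^ 3 + 12 * (a - β ^ 2) * β) * hthree - h
        rw [pencilDisc_parallel_eq, h27, C_0, zero_mul, zero_add]
        compute_degree!
      omega
  · have h27 : (-27 : K) ≠ 0 := by
      rw [show (-27 : K) = -(3 ^ 3) by norm_num]
      exact neg_ne_zero.mpr (pow_ne_zero 3 hthree)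
    have h4 : (pencilDisc a b c 0 β 1 0).natDegree = 4 := by
      rw [pencilDisc_parallel_eq]
      compute_degree!
      exact fun h => h27 (by rw [h, neg_zero])
    obtain ⟨τ₁, τ₂, hfac⟩ := exists_roots_of_natDegree_eq_two (S := S) (by omega)
    obtain ⟨r₁, a1, b1, c1, y1⟩ := hdvd1 τ₁ ⟨C S.leadingCoeff * (X - C τ₂), by
      conv_lhs => rw [hfac]
      ring⟩
    obtain ⟨r₂, a2, b2, c2, y2⟩ := hdvd1 τ₂ ⟨C S.leadingCoeff * (X - C τ₁), by
      conv_lhs => rw [hfac]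
      ring⟩
    have n12 : τ₁ ≠ τ₂ := fun h => by
      have hsq : (X - C τ₁) ^ 2 ∣ S := ⟨C S.leadingCoeff, by
        conv_lhs => rw [hfac, ← h]
        ring⟩
      have h := sq_dvd_of_eq_sq hκ hS hsq
      rw [a1, b1, c1, pencilDisc_parallel_expansion, ← pow_mul, pow_add _ 2 2,
        mul_dvd_mul_iff_left (pow_ne_zero 2 (X_sub_C_ne_zero τ₁))] at h
      refine mul_ne_zero ?_ (pow_ne_zero 2 y1) (coeffs_eq_zero_of_sq_dvd h).1
      rw [show (-108 : K) = 2 ^ 2 * -27 by norm_num]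
      exact mul_ne_zero (pow_ne_zero 2 h2) h27
    have hr : r₁ = r₂ := mul_left_cancel₀ hthree (by linear_combination a1 - a2)
    rw [← hr] at b2
    have hβ : (2 * (τ₁ - τ₂)) * β = 0 := by linear_combination b2 - b1
    have hβ0 : β = 0 :=
      (mul_eq_zero.mp hβ).resolve_left (mul_ne_zero h2 (sub_ne_zero.mpr n12))
    exact hj (by rw [a1, b1, hβ0]; ring)

end NonSquare

section Secant

open Polynomial

lemma exists_three_secant_of_parallel (hq : 121 ≤ Fintype.card F) (hodd : Odd (Fintype.card F))
    (h2 : (2 : F) ≠ 0) {a b c : F} (hD : cubicDisc a b c ≠ 0) (hj : a ^ 2 - 3 * b ≠ 0) (β : F) :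
    ∃ t x₁ x₂ x₃, x₁ ≠ x₂ ∧ x₁ ≠ x₃ ∧ x₂ ≠ x₃ ∧ ∀ x, x = x₁ ∨ x = x₂ ∨ x = x₃ →
      (t + β * x) ^ 2 = x ^ 3 + a * x ^ 2 + b * x + c := by
  obtain ⟨K, _, _, ⟨φ⟩⟩ : ∃ (K : Type) (_ : Field K) (_ : IsAlgClosed K), Nonempty (F →+* K) :=
    ⟨AlgebraicClosure F, inferInstance, inferInstance, ⟨algebraMap _ _⟩⟩
  have hns : NonSq (pencilDisc a b c 0 β 1 0) := by
    refine NonSq.of_map φ ?_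
    rw [pencilDisc_map, map_zero, map_one]
    refine nonSq_pencilDisc_parallel ?_ ?_ ?_
    · rwa [← map_ofNat φ 2, _root_.map_ne_zero]
    · rw [← _root_.map_ne_zero φ] at hD
      simpa [cubicDisc, _root_.map_ofNat] using hD
    · rw [← _root_.map_ne_zero φ] at hj
      simpa [_root_.map_ofNat] using hj
  have hdeg : (pencilDisc a b c 0 β 1 0).natDegree ≤ 6 := by
    rw [pencilDisc_parallel_eq]
    compute_degree!
  obtain ⟨t, x₁, x₂, x₃, h12, h13, h23, h⟩ := exists_three_secant_of_nonSq hq hodd hD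
    (Or.inl one_ne_zero) (fun x h => absurd h (by simp)) hdeg hns
  refine ⟨t, x₁, x₂, x₃, h12, h13, h23, fun x hx => ?_⟩
  linear_combination h x hx

lemma exists_three_secant_of_ne (hq : 121 ≤ Fintype.card F) (hodd : Odd (Fintype.card F))
    (h2 : (2 : F) ≠ 0) {a b c α : F} (hD : cubicDisc a b c ≠ 0) (hj : a ^ 2 - 3 * b ≠ 0)
    (hα : α ^ 2 ≠ c) :
    ∃ t x₁ x₂ x₃, x₁ ≠ x₂ ∧ x₁ ≠ x₃ ∧ x₂ ≠ x₃ ∧ ∀ x, x = x₁ ∨ x = x₂ ∨ x = x₃ →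
      (α + t * x) ^ 2 = x ^ 3 + a * x ^ 2 + b * x + c := by
  obtain ⟨K, _, _, ⟨φ⟩⟩ : ∃ (K : Type) (_ : Field K) (_ : IsAlgClosed K), Nonempty (F →+* K) :=
    ⟨AlgebraicClosure F, inferInstance, inferInstance, ⟨algebraMap _ _⟩⟩
  have hns : NonSq (pencilDisc a b c α 0 0 1) := by
    refine NonSq.of_map φ ?_
    rw [pencilDisc_map, map_zero, map_one]
    refine nonSq_pencilDisc_point ?_ ?_ ?_ ?_
    · rwa [← map_ofNat φ 2, _root_.map_ne_zero]
    · rw [← _root_.map_ne_zero φ] at hD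
      simpa [cubicDisc, _root_.map_ofNat] using hD
    · rw [← _root_.map_ne_zero φ] at hj
      simpa [_root_.map_ofNat] using hj
    · rw [← map_pow]
      exact fun h => hα (φ.injective h)
  have hdeg : (pencilDisc a b c α 0 0 1).natDegree ≤ 6 := by
    rw [pencilDisc_point_eq]
    compute_degree!
  obtain ⟨t, x₁, x₂, x₃, h12, h13, h23, h⟩ := exists_three_secant_of_nonSq hq hodd hD
    (Or.inr one_ne_zero) (fun x h => by
      obtain rfl : x = 0 := by linear_combination h
      simpa using hα) hdeg hns
  refine ⟨t, x₁, x₂, x₃, h12, h13, h23, fun x hx => ?_⟩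
  linear_combination h x hx

lemma exists_three_secant_of_eq (hq : 121 ≤ Fintype.card F) (hodd : Odd (Fintype.card F))
    (h2 : (2 : F) ≠ 0) {a b c α : F} (hD : cubicDisc a b c ≠ 0) (hα : α ^ 2 = c) :
    ∃ t x₁ x₂ x₃, x₁ ≠ x₂ ∧ x₁ ≠ x₃ ∧ x₂ ≠ x₃ ∧ ∀ x, x = x₁ ∨ x = x₂ ∨ x = x₃ →
      (α + t * x) ^ 2 = x ^ 3 + a * x ^ 2 + b * x + c := by
  set P : F[X] := X ^ 4 + C (-2 * a) * X ^ 2 + C (8 * α) * X + C (a ^ 2 - 4 * b) with hP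
  set R : F[X] := C (2 * α) * X - C b with hR
  have hP0 : P ≠ 0 := by
    have : P.natDegree = 4 := by rw [hP]; compute_degree!
    rintro h
    rw [h] at this; simp at this
  have hR0 : R ≠ 0 := by
    intro h
    have e0 : b = 0 := by simpa [hR] using congrArg (eval 0) h
    have e1 : 2 * α - b = 0 := by simpa [hR] using congrArg (eval 1) h
    have hα0 : α = 0 := (mul_eq_zero.mp (show 2 * α = 0 by rw [← e1, e0]; ring)).resolve_left h2
    exact hD (by rw [← hα, e0, hα0, cubicDisc]; ring)
  have hPd : P.natDegree ≤ 4 := by rw [hP]; compute_degree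
  have hRd : R.natDegree ≤ 1 := by rw [hR]; compute_degree
  have hcard : (P * R).roots.toFinset.card ≤ 5 :=
    (Multiset.toFinset_card_le _).trans <| (card_roots' _).trans <|
      natDegree_mul_le.trans (by omega)
  obtain ⟨p, hp, hp0, hpt⟩ : ∃ p ∈ affPoints a b c, p.1 ≠ 0 ∧
      (p.2 - α) / p.1 ∉ (P * R).roots.toFinset := by
    by_contra! hcon
    have h0 : ((affPoints a b c).filter fun p => p.1 = 0).card ≤ 2 := by
      refine (Finset.card_le_card (t := {(0, α), (0, -α)}) fun p hp => ?_).trans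
        Finset.card_le_two
      obtain ⟨x, y⟩ := p
      obtain ⟨hp, rfl : x = 0⟩ := Finset.mem_filter.mp hp
      have hy : y ^ 2 = α ^ 2 := by
        have := (Finset.mem_filter.mp hp).2
        rw [hα]; linear_combination this
      rcases sq_eq_sq_iff_eq_or_eq_neg.mp hy with rfl | rfl <;> simp
    have h1 : ((affPoints a b c).filter fun p => ¬ p.1 = 0).card ≤ 5 := by
      refine (Finset.card_le_card_of_injOn (fun p => (p.2 - α) / p.1) (fun p hp => ?_) ?_).trans
        hcard
      · obtain ⟨hp, hp0⟩ := Finset.mem_filter.mp hp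
        exact hcon p hp hp0
      · rintro ⟨x, y⟩ hp ⟨x', y'⟩ hp' (h : (y - α) / x = (y' - α) / x')
        obtain ⟨hp, hx : x ≠ 0⟩ := Finset.mem_filter.mp hp
        obtain ⟨hp', hx' : x' ≠ 0⟩ := Finset.mem_filter.mp hp'
        have ht := hcon _ hp hx
        obtain ⟨t, htd⟩ : ∃ t, t = (y - α) / x := ⟨_, rfl⟩
        have hy : y = α + t * x := by rw [htd, div_mul_cancel₀ _ hx]; ring
        have hy' : y' = α + t * x' := by rw [htd, h, div_mul_cancel₀ _ hx']; ring
        have key : ∀ z, z ≠ 0 → (z, α + t * z) ∈ affPoints a b c →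
            z ^ 2 + (a - t ^ 2) * z + (b - 2 * α * t) = 0 := by
          intro z hz hm
          refine (mul_eq_zero.mp ?_).resolve_left hz
          have := (Finset.mem_filter.mp hm).2
          linear_combination - this + hα
        have k := key x hx (hy ▸ hp)
        have k' := key x' hx' (hy' ▸ hp')
        have hxx : x = x' := by
          rw [← htd, Multiset.mem_toFinset, mem_roots (mul_ne_zero hP0 hR0), IsRoot, eval_mul,
            mul_eq_zero] at ht
          rcases ht with ht | ht
          · have dbl : ∀ z, z ^ 2 + (a - t ^ 2) * z + (b - 2 * α * t) = 0 →
                2 * z = t ^ 2 - a := by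
              intro z hz
              have : (2 * z + (a - t ^ 2)) ^ 2 = 0 := by
                simp [hP] at ht
                linear_combination 4 * hz + ht
              linear_combination (pow_eq_zero_iff two_ne_zero).mp this
            exact mul_left_cancel₀ h2 ((dbl x k).trans (dbl x' k').symm)
          · have hb : b = 2 * α * t := by
              simp [hR] at ht
              linear_combination - ht
            have lin : ∀ z, z ≠ 0 → z ^ 2 + (a - t ^ 2) * z + (b - 2 * α * t) = 0 →
                z = t ^ 2 - a := fun z hz h => mul_left_cancel₀ hz (by
              linear_combination h - hb)
            exact (lin x hx k).trans (lin x' hx' k').symm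
        rw [hy, hy', hxx]
    have h2' := Finset.card_filter_add_card_filter_not (s := affPoints a b c) (fun p => p.1 = 0)
    have := le_card_affPoints hq hodd hD
    omega
  obtain ⟨x, y⟩ := p
  replace hp := (Finset.mem_filter.mp hp).2
  simp only at hp hp0 hpt
  obtain ⟨t, htd⟩ : ∃ t, t = (y - α) / x := ⟨_, rfl⟩
  rw [← htd, Multiset.mem_toFinset, mem_roots (mul_ne_zero hP0 hR0), IsRoot, eval_mul,
    mul_eq_zero, not_or] at hpt
  have hy : y = α + t * x := by rw [htd, div_mul_cancel₀ _ hp0]; ring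
  have k : x ^ 2 + (a - t ^ 2) * x + (b - 2 * α * t) = 0 := by
    refine (mul_eq_zero.mp ?_).resolve_left hp0
    rw [hy] at hp
    linear_combination - hp + hα
  refine ⟨t, 0, x, t ^ 2 - a - x, hp0.symm, fun h => hpt.2 ?_, fun h => hpt.1 ?_, ?_⟩
  · simp only [hR, eval_sub, eval_mul, eval_C, eval_X]
    linear_combination x * h - k
  · simp only [hP, eval_add, eval_pow, eval_mul, eval_C, eval_X]
    linear_combination (2 * x + a - t ^ 2) * h - 4 * k
  · rintro z (rfl | rfl | rfl)
    · linear_combination hα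
    · linear_combination hα - z * k
    · linear_combination hα - (t ^ 2 - a - x) * k

/-- Every affine point lies on a line `y = y₀ + t (x - x₀)` meeting the curve in three
points. -/
lemma exists_three_secant_through (hq : 121 ≤ Fintype.card F) (hodd : Odd (Fintype.card F))
    (h2 : (2 : F) ≠ 0) {a b c : F} (hD : cubicDisc a b c ≠ 0) (hj : a ^ 2 - 3 * b ≠ 0)
    (x₀ y₀ : F) :
    ∃ t x₁ x₂ x₃, x₁ ≠ x₂ ∧ x₁ ≠ x₃ ∧ x₂ ≠ x₃ ∧ ∀ x, x = x₁ ∨ x = x₂ ∨ x = x₃ →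
      ((y₀ - t * x₀) + t * x) ^ 2 = x ^ 3 + a * x ^ 2 + b * x + c := by
  have hD' : cubicDisc (a + 3 * x₀) (b + 2 * a * x₀ + 3 * x₀ ^ 2)
      (x₀ ^ 3 + a * x₀ ^ 2 + b * x₀ + c) ≠ 0 := by
    convert hD using 1
    simp only [cubicDisc]; ring
  have hj' : (a + 3 * x₀) ^ 2 - 3 * (b + 2 * a * x₀ + 3 * x₀ ^ 2) ≠ 0 := by
    convert hj using 1
    ring
  obtain ⟨t, x₁, x₂, x₃, h12, h13, h23, h⟩ :=
    if hα : y₀ ^ 2 = x₀ ^ 3 + a * x₀ ^ 2 + b * x₀ + c then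
      exists_three_secant_of_eq hq hodd h2 hD' hα
    else exists_three_secant_of_ne hq hodd h2 hD' hj' hα
  refine ⟨t, x₁ + x₀, x₂ + x₀, x₃ + x₀, by simpa, by simpa, by simpa, fun x hx => ?_⟩
  have := h (x - x₀) (by simpa only [sub_eq_iff_eq_add] using hx)
  linear_combination this

end Secant

lemma onHyp_mk {k : ℕ} (a v : Fin k → F) (hv : v ≠ 0) :
    OnHyp a (Projectivization.mk F v hv) ↔ ∑ i, a i * v i = 0 := by
  obtain ⟨u, hu⟩ := Projectivization.exists_smul_eq_mk_rep F v hv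
  have h : ∀ i, a i * (Projectivization.mk F v hv).rep i = u * (a i * v i) := fun i => by
    rw [← hu, Pi.smul_apply, Units.smul_def, smul_eq_mul]; ring
  simp only [OnHyp, h, ← Finset.mul_sum, mul_eq_zero, u.ne_zero, false_or]

lemma onHyp_phiProj_zero (W : WeierstrassCurve F) (A B : F) :
    OnHyp ![A, B, 1, 0] (phiProj W (k := 4) (by norm_num) .zero) := by
  simp [phiProj, onHyp_mk, phiVec, Fin.sum_univ_four]

lemma onHyp_phiProj_some (W : WeierstrassCurve F) (A B : F) {x y : F}
    (h : W.toAffine.Nonsingular x y) :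
    OnHyp ![A, B, 1, 0] (phiProj W (k := 4) (by norm_num) (.some x y h)) ↔
      A + B * x + y = 0 := by
  simp [phiProj, onHyp_mk, phiVec, psi, Fin.sum_univ_four]

lemma phiProj_some_ne_zero (W : WeierstrassCurve F) {x y : F} (h : W.toAffine.Nonsingular x y) :
    phiProj W (k := 4) (by norm_num) .zero ≠ phiProj W (k := 4) (by norm_num) (.some x y h) := by
  intro e
  obtain ⟨u, hu⟩ := (Projectivization.mk_eq_mk_iff _ _ _ _ _).mp e
  have := congrFun hu 0
  simp [phiVec, Units.smul_def] at this

lemma fst_eq_of_phiProj_some_eq (W : WeierstrassCurve F) {x y x' y' : F}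
    {h : W.toAffine.Nonsingular x y} {h' : W.toAffine.Nonsingular x' y'}
    (e : phiProj W (k := 4) (by norm_num) (.some x y h) =
      phiProj W (k := 4) (by norm_num) (.some x' y' h')) : x = x' := by
  obtain ⟨u, hu⟩ := (Projectivization.mk_eq_mk_iff _ _ _ _ _).mp e
  have h0 := congrFun hu 0
  have h1 := congrFun hu 1
  simp [phiVec, psi, Units.smul_def] at h0 h1
  simp [← h1, h0]

/-- A plane containing `(0 : 0 : 0 : 1)` and not `(0 : 0 : 1 : 0)` that meets the elliptic quartic
in three affine points meets it in exactly four points. -/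
lemma ncard_onHyp_eq_four (W : WeierstrassCurve F) (ha₁ : W.a₁ = 0) (ha₃ : W.a₃ = 0)
    [W.IsElliptic] {m l x₁ x₂ x₃ : F} (h12 : x₁ ≠ x₂) (h13 : x₁ ≠ x₃) (h23 : x₂ ≠ x₃)
    (h : ∀ x, x = x₁ ∨ x = x₂ ∨ x = x₃ →
      (m + l * x) ^ 2 = x ^ 3 + W.a₂ * x ^ 2 + W.a₄ * x + W.a₆) :
    Set.ncard {p ∈ Set.range (phiProj W (k := 4) (by norm_num)) |
      OnHyp ![-m, -l, 1, 0] p} = 4 := by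
  have hns : ∀ x, x = x₁ ∨ x = x₂ ∨ x = x₃ → W.toAffine.Nonsingular x (m + l * x) :=
    fun x hx => WeierstrassCurve.Affine.equation_iff_nonsingular.mp <|
      (WeierstrassCurve.Affine.equation_iff ..).mpr <| by rw [ha₁, ha₃]; linear_combination h x hx
  have n1 := hns x₁ (by simp)
  have n2 := hns x₂ (by simp)
  have n3 := hns x₃ (by simp)
  have hset : {p ∈ Set.range (phiProj W (k := 4) (by norm_num)) | OnHyp ![-m, -l, 1, 0] p} =
      ({phiProj W (by norm_num) .zero, phiProj W (by norm_num) (.some _ _ n1),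
        phiProj W (by norm_num) (.some _ _ n2), phiProj W (by norm_num) (.some _ _ n3)} :
        Set (Projectivization F (Fin 4 → F))) := by
    ext p
    simp only [Set.mem_insert_iff, Set.mem_singleton_iff]
    constructor
    · rintro ⟨⟨P, rfl⟩, hP⟩
      cases P with
      | zero => exact Or.inl rfl
      | some x y hxy =>
        rw [onHyp_phiProj_some] at hP
        obtain rfl : y = m + l * x := by linear_combination hP
        have hx : (m + l * x) ^ 2 = x ^ 3 + W.a₂ * x ^ 2 + W.a₄ * x + W.a₆ := by
          have := (WeierstrassCurve.Affine.equation_iff ..).mp hxy.1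
          rw [ha₁, ha₃] at this
          linear_combination this
        have hr : ∀ z, (m + l * z) ^ 2 = z ^ 3 + W.a₂ * z ^ 2 + W.a₄ * z + W.a₆ →
            z ^ 3 + (W.a₂ - l ^ 2) * z ^ 2 + (W.a₄ - 2 * m * l) * z + (W.a₆ - m ^ 2) = 0 :=
          fun z hz => by linear_combination - hz
        obtain ⟨hb, hc⟩ := cubic_coeffs_of_two_roots h12 (hr _ (h x₁ (by simp)))
          (hr _ (h x₂ (by simp)))
        have third : ∀ z, z ≠ x₁ → z ≠ x₂ →
            (m + l * z) ^ 2 = z ^ 3 + W.a₂ * z ^ 2 + W.a₄ * z + W.a₆ →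
            z = -(W.a₂ - l ^ 2) - x₁ - x₂ := fun z z1 z2 hz =>
          mul_left_cancel₀ (mul_ne_zero (sub_ne_zero.mpr z1) (sub_ne_zero.mpr z2)) (by
            linear_combination hr z hz - z * hb - hc)
        rcases eq_or_ne x x₁ with rfl | ne1
        · simp
        rcases eq_or_ne x x₂ with rfl | ne2
        · simp
        obtain rfl : x = x₃ :=
          (third x ne1 ne2 hx).trans (third x₃ h13.symm h23.symm (h x₃ (by simp))).symm
        simp
    · rintro (rfl | rfl | rfl | rfl)
      · exact ⟨⟨_, rfl⟩, onHyp_phiProj_zero W _ _⟩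
      all_goals exact ⟨⟨_, rfl⟩, (onHyp_phiProj_some W _ _ _).mpr (by ring)⟩
  rw [hset, Set.ncard_insert_of_notMem, Set.ncard_insert_of_notMem, Set.ncard_pair]
  · exact fun e => h23 (fst_eq_of_phiProj_some_eq W e)
  · rintro (e | e)
    · exact h12 (fst_eq_of_phiProj_some_eq W e)
    · exact h13 (fst_eq_of_phiProj_some_eq W e)
  · rintro (e | e | e) <;> exact phiProj_some_ne_zero W _ e

/-- Let `q ≥ 121` be odd and `E : Y² = X³ + aX² + bX + c` with `j(E) ≠ 0`.
If a point `Q = (Q₁ : Q₂ : Q₃ : Q₄)` of `P³(F_q) \ φ₄(E(F_q))` can be added to the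
`(n; 4, 2)`-set `φ₄(E(F_q))`, then `Q` lies on the line through `(0:0:1:0)` and `(0:0:0:1)`,
i.e. `Q₁ = Q₂ = 0`. -/
theorem statement18 (hq : 121 ≤ Fintype.card F) (hodd : Odd (Fintype.card F))
    (W : WeierstrassCurve F) (ha₁ : W.a₁ = 0) (ha₃ : W.a₃ = 0) [W.IsElliptic]
    (hj : W.j ≠ 0) {n : ℕ} (hn : n = Nat.card W.toAffine.Point)
    (Qv : Fin 4 → F) (hQv : Qv ≠ 0)
    (hQnotin : Projectivization.mk F Qv hQv ∉
      Set.range (phiProj W (k := 4) (by norm_num)))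
    (hadd : ∀ a : Fin 4 → F, a ≠ 0 → OnHyp a (Projectivization.mk F Qv hQv) →
      Set.ncard {p ∈ Set.range (phiProj W (k := 4) (by norm_num)) | OnHyp a p} ≠ 4) :
    Qv 0 = 0 ∧ Qv 1 = 0 := by
  have h2 : (2 : F) ≠ 0 := Ring.two_ne_zero <|
    FiniteField.even_card_iff_char_two.not.mpr (by rw [Nat.odd_iff] at hodd; omega)
  have hD : cubicDisc W.a₂ W.a₄ W.a₆ ≠ 0 := fun h => W.isUnit_Δ.ne_zero <| by
    rw [cubicDisc] at h
    simp only [WeierstrassCurve.Δ, WeierstrassCurve.b₂, WeierstrassCurve.b₄, WeierstrassCurve.b₆,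
      WeierstrassCurve.b₈, ha₁, ha₃]
    linear_combination 16 * h
  have hj' : W.a₂ ^ 2 - 3 * W.a₄ ≠ 0 := fun h => hj <| W.j_eq_zero <| by
    simp only [WeierstrassCurve.c₄, WeierstrassCurve.b₂, WeierstrassCurve.b₄, ha₁, ha₃]
    linear_combination 16 * h
  have hcontra : ∀ m l x₁ x₂ x₃ : F, x₁ ≠ x₂ → x₁ ≠ x₃ → x₂ ≠ x₃ →
      (∀ x, x = x₁ ∨ x = x₂ ∨ x = x₃ →
        (m + l * x) ^ 2 = x ^ 3 + W.a₂ * x ^ 2 + W.a₄ * x + W.a₆) →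
      Qv 2 = m * Qv 0 + l * Qv 1 → False := by
    intro m l x₁ x₂ x₃ h12 h13 h23 h hQ
    refine hadd ![-m, -l, 1, 0] (fun e => ?_) ?_ (ncard_onHyp_eq_four W ha₁ ha₃ h12 h13 h23 h)
    · simpa using congrFun e 2
    · rw [onHyp_mk]
      simp [Fin.sum_univ_four]
      linear_combination hQ
  have h0 : Qv 0 = 0 := by
    by_contra h0
    obtain ⟨t, x₁, x₂, x₃, h12, h13, h23, h⟩ := exists_three_secant_through hq hodd h2 hD hj'
      (Qv 1 / Qv 0) (Qv 2 / Qv 0)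
    refine hcontra _ _ x₁ x₂ x₃ h12 h13 h23 h ?_
    field_simp
    ring
  refine ⟨h0, ?_⟩
  by_contra h1
  obtain ⟨t, x₁, x₂, x₃, h12, h13, h23, h⟩ := exists_three_secant_of_parallel hq hodd h2 hD hj'
    (Qv 2 / Qv 1)
  refine hcontra _ _ x₁ x₂ x₃ h12 h13 h23 h ?_
  rw [h0]
  field_simp
  ring

end NMDS
end

section
/- Let q be a prime power and let E be an elliptic curve defined over F_q having exactly n F_q-rational points. Then for every k = 2, 3, …, n−1 there exists a near-MDS linear [n, k, n−k]_q code over F_q. -/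
set_option linter.unusedSectionVars false

namespace NMDS

open WeierstrassCurve

variable {F : Type} [Field F] [Fintype F] [DecidableEq F]

section Code

open Module Finset

variable {n k : ℕ}

lemma mem_dualCode {C : Submodule F (Fin n → F)} {x : Fin n → F} :
    x ∈ dualCode C ↔ ∀ y ∈ C, ∑ i, x i * y i = 0 := by
  simp [dualCode, dotLin]

lemma finrank_dualCode (C : Submodule F (Fin n → F)) :
    finrank F (dualCode C) = n - finrank F C := by
  have hB : (Matrix.toBilin' (1 : Matrix (Fin n) (Fin n) F)).Nondegenerate := by
    rw [Matrix.nondegenerate_toBilin'_iff]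
    exact Matrix.nondegenerate_of_det_ne_zero (by simp)
  have h : dualCode C = (Matrix.toBilin' (1 : Matrix (Fin n) (Fin n) F)).orthogonal C := by
    ext x
    simp [mem_dualCode, LinearMap.BilinForm.mem_orthogonal_iff, Matrix.toBilin'_apply',
      dotProduct, mul_comm]
  rw [h, LinearMap.BilinForm.finrank_orthogonal hB]
  simp

lemma minDist_eq {C : Submodule F (Fin n → F)} {d : ℕ}
    (hle : ∀ x ∈ C, x ≠ 0 → d ≤ hammingNorm x) (hex : ∃ x ∈ C, x ≠ 0 ∧ hammingNorm x ≤ d) :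
    minDist C = d := by
  obtain ⟨x, hxC, hx0, hx⟩ := hex
  have hmem : hammingNorm x ∈ {d | ∃ x ∈ C, x ≠ 0 ∧ hammingNorm x = d} := ⟨x, hxC, hx0, rfl⟩
  refine le_antisymm ((Nat.sInf_le hmem).trans hx) ?_
  refine le_csInf ⟨_, hmem⟩ ?_
  rintro _ ⟨y, hyC, hy0, rfl⟩
  exact hle y hyC hy0

lemma hammingNorm_add_card_zeros (x : Fin n → F) : hammingNorm x + #{i | x i = 0} = n := by
  have := Finset.card_filter_add_card_filter_not (s := univ) (fun i => x i = 0)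
  simp only [card_univ, Fintype.card_fin] at this
  rw [hammingNorm]
  simpa [add_comm] using this

/-- A functional on `F ^ S` gives a vector supported on `S`. -/
lemma exists_supported_vector (S : Finset (Fin n)) (g : (S → F) →ₗ[F] F) (hg : g ≠ 0) :
    ∃ y : Fin n → F, y ≠ 0 ∧ hammingNorm y ≤ #S ∧
      ∀ x : Fin n → F, ∑ i, y i * x i = g fun i => x i := by
  let y : Fin n → F := fun i => if h : i ∈ S then g (Pi.single ⟨i, h⟩ 1) else 0
  have hy : ∀ x : Fin n → F, ∑ i, y i * x i = g fun i => x i := by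
    intro x
    rw [LinearMap.pi_apply_eq_sum_univ g, ← Finset.sum_subset (Finset.subset_univ S),
      ← Finset.sum_coe_sort S]
    · refine Finset.sum_congr rfl fun i _ => ?_
      have hi : (Pi.single i 1 : S → F) = fun j => if i = j then 1 else 0 := by
        ext j
        simp [Pi.single_apply, eq_comm]
      simp [y, mul_comm, hi]
    · intro i _ hi
      simp [y, hi]
  refine ⟨y, ?_, ?_, hy⟩
  · rintro h0
    refine hg (LinearMap.ext fun z => ?_)
    have := hy fun i => if h : i ∈ S then z ⟨i, h⟩ else 0
    simpa [h0] using this.symm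
  · refine Finset.card_le_card fun i hi => ?_
    by_contra h
    simp [y, h] at hi

/-- A family of evaluation words on a `k`-dimensional space spans a near-MDS code as soon as
nonzero words have at most `k` zeros, this bound is attained, and words vanishing on a common
set of `k - 1` positions are proportional. -/
theorem isNMDS_range {V : Type*} [AddCommGroup V] [Module F V] [FiniteDimensional F V]
    (ev : V →ₗ[F] Fin n → F) (hV : finrank F V = k) (hk : 1 ≤ k) (hkn : k < n)
    (hzeros : ∀ v ≠ 0, #{i | ev v i = 0} ≤ k)
    (hprop : ∀ S : Finset (Fin n), #S + 1 = k → ∀ v w, v ≠ 0 → (∀ i ∈ S, ev v i = 0) →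
      (∀ i ∈ S, ev w i = 0) → ∃ c : F, c • v = w)
    (hex : ∃ v ≠ 0, k ≤ #{i | ev v i = 0}) :
    finrank F (LinearMap.range ev) = k ∧ minDist (LinearMap.range ev) = n - k ∧
      IsNMDS (LinearMap.range ev) := by
  have hinj : Function.Injective ev := by
    rw [← LinearMap.ker_eq_bot, LinearMap.ker_eq_bot']
    intro v hv
    by_contra h0
    have := hzeros v h0
    simp [hv] at this
    omega
  have hrank : finrank F (LinearMap.range ev) = k := by
    rw [LinearMap.finrank_range_of_inj hinj, hV]
  have hdist : minDist (LinearMap.range ev) = n - k := by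
    apply minDist_eq
    · rintro _ ⟨v, rfl⟩ hv
      have := hzeros v (by rintro rfl; simp at hv)
      have := hammingNorm_add_card_zeros (ev v)
      omega
    · obtain ⟨v, hv0, hv⟩ := hex
      refine ⟨ev v, ⟨v, rfl⟩, ?_, ?_⟩
      · rwa [Ne, map_eq_zero_iff ev hinj]
      · have := hammingNorm_add_card_zeros (ev v)
        omega
  have hdual : minDist (dualCode (LinearMap.range ev)) = k := by
    apply minDist_eq
    · intro y hy hy0
      by_contra! hlt
      obtain ⟨i, hi⟩ := Function.ne_iff.mp hy0
      obtain ⟨S, hyS, hS⟩ : ∃ S : Finset (Fin n), ({i | y i ≠ 0} : Finset (Fin n)) ⊆ S ∧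
          #S = k - 1 := by
        refine Finset.exists_superset_card_eq ?_ ?_
        · exact Nat.le_sub_one_of_lt hlt
        · simp; omega
      let r : V →ₗ[F] (S → F) := LinearMap.funLeft F F (Subtype.val : S → Fin n) ∘ₗ ev
      have hr : ∀ v, r v = 0 ↔ ∀ i ∈ S, ev v i = 0 := by
        intro v
        simp [r, funext_iff, LinearMap.funLeft]
      have hker : finrank F (LinearMap.ker r) ≤ 1 := by
        by_cases hb : ∃ v ∈ LinearMap.ker r, v ≠ 0
        · obtain ⟨v, hv, hv0⟩ := hb
          refine finrank_le_one ⟨v, hv⟩ fun w => ?_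
          obtain ⟨c, hc⟩ := hprop S (by omega) v w hv0 ((hr v).1 hv) ((hr w).1 w.2)
          exact ⟨c, Subtype.ext hc⟩
        · push Not at hb
          rw [(Submodule.eq_bot_iff _).2 hb]
          simp
      have hsurj : Function.Surjective r := by
        rw [← LinearMap.range_eq_top]
        apply Submodule.eq_top_of_finrank_eq
        have h1 := LinearMap.finrank_range_add_finrank_ker r
        have h2 := Submodule.finrank_le (LinearMap.range r)
        have h3 : finrank F (S → F) = k - 1 := by simp [hS]
        omega
      have hiS : i ∈ S := hyS (by simpa using hi)
      obtain ⟨v, hv⟩ := hsurj (Pi.single ⟨i, hiS⟩ 1)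
      have hsum := mem_dualCode.1 hy (ev v) ⟨v, rfl⟩
      rw [Finset.sum_eq_single i] at hsum
      · have : ev v i = 1 := by simpa [r, LinearMap.funLeft] using congrFun hv ⟨i, hiS⟩
        rw [this, mul_one] at hsum
        exact hi hsum
      · intro j _ hj
        by_cases hjS : j ∈ S
        · have : ev v j = 0 := by
            simpa [r, LinearMap.funLeft, Pi.single_apply, hj] using congrFun hv ⟨j, hjS⟩
          rw [this, mul_zero]
        · have : y j = 0 := by
            by_contra h
            exact hjS (hyS (by simpa using h))
          rw [this, zero_mul]
      · simp
    · obtain ⟨v, hv0, hv⟩ := hex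
      obtain ⟨S, hvS, hS⟩ := Finset.exists_subset_card_eq hv
      let r : V →ₗ[F] (S → F) := LinearMap.funLeft F F (Subtype.val : S → Fin n) ∘ₗ ev
      have hrv : r v = 0 := by
        ext i
        have := hvS i.2
        simpa [r, LinearMap.funLeft] using this
      have hlt : LinearMap.range r < ⊤ := by
        rw [lt_top_iff_ne_top]
        intro htop
        have h1 := LinearMap.finrank_range_add_finrank_ker r
        rw [htop, finrank_top] at h1
        have h3 : finrank F (S → F) = k := by simp [hS]
        have h4 : finrank F (LinearMap.ker r) = 0 := by omega
        rw [Submodule.finrank_eq_zero] at h4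
        exact hv0 (LinearMap.ker_eq_bot'.1 h4 v hrv)
      obtain ⟨g, hg0, hg⟩ := Submodule.exists_le_ker_of_lt_top _ hlt
      obtain ⟨y, hy0, hyS, hy⟩ := exists_supported_vector S g hg0
      refine ⟨y, mem_dualCode.2 ?_, hy0, hS ▸ hyS⟩
      rintro _ ⟨w, rfl⟩
      rw [hy]
      exact hg ⟨w, rfl⟩
  refine ⟨hrank, hdist, ?_, ?_⟩
  · rw [singletonDefect, hrank, hdist]
    omega
  · rw [singletonDefect, finrank_dualCode, hrank, hdual]
    omega

end Code

section SubsetSum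

open Finset

variable {G : Type*} [AddCommGroup G] [DecidableEq G]

lemma exists_subset_sum_eq_zero_of_neg_mem {A : Finset G} (hA : ∀ g ∈ A, -g ∈ A)
    (hne : ∀ g ∈ A, -g ≠ g) (m : ℕ) (hm : 2 * m ≤ #A) :
    ∃ B ⊆ A, (∀ g ∈ B, -g ∈ B) ∧ #B = 2 * m ∧ ∑ g ∈ B, g = 0 := by
  induction m with
  | zero => exact ⟨∅, by simp⟩
  | succ m ih =>
    obtain ⟨B, hBA, hB, hcard, hsum⟩ := ih (by omega)
    obtain ⟨g, hgA, hgB⟩ : ∃ g ∈ A, g ∉ B := by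
      by_contra! h
      have := card_le_card h
      omega
    have hgB' : -g ∉ B := fun h => hgB (by simpa using hB _ h)
    have hgi : g ∉ insert (-g) B := by simp [hgB, (hne g hgA).symm]
    refine ⟨insert g (insert (-g) B), ?_, ?_, ?_, ?_⟩
    · intro x
      simp only [mem_insert]
      rintro (rfl | rfl | h)
      exacts [hgA, hA _ hgA, hBA h]
    · intro x
      simp only [mem_insert]
      rintro (rfl | rfl | h)
      · simp
      · simp
      · simp [hB x h]
    · rw [card_insert_of_notMem hgi, card_insert_of_notMem hgB', hcard]
      ring
    · rw [sum_insert hgi, sum_insert hgB', hsum]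
      abel

lemma even_card_of_neg_mem {A : Finset G} (hA : ∀ g ∈ A, -g ∈ A) (hne : ∀ g ∈ A, -g ≠ g) :
    Even #A := by
  by_contra h
  rw [Nat.not_even_iff_odd] at h
  obtain ⟨m, hm⟩ := h
  obtain ⟨B, hBA, hB, hcard, -⟩ := exists_subset_sum_eq_zero_of_neg_mem hA hne m (by omega)
  obtain ⟨g, hg⟩ := card_eq_one.1 (show #(A \ B) = 1 by
    rw [card_sdiff_of_subset hBA]; omega)
  have hgm : g ∈ A \ B := by simp [hg]
  rw [mem_sdiff] at hgm
  have : -g ∈ A \ B := mem_sdiff.2 ⟨hA g hgm.1, fun h => hgm.2 (by simpa using hB _ h)⟩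
  rw [hg, mem_singleton] at this
  exact hne g hgm.1 this

/-- In a finite abelian group with at most four elements killed by `2`, every size smaller than
the order is the size of a zero-sum subset, except for size two in the Klein four-group. -/
theorem exists_card_eq_sum_eq_zero [Fintype G] {k : ℕ} (hT : #{g : G | -g = g} ≤ 4)
    (hk : k < Fintype.card G) (hex : ¬ (k = 2 ∧ Fintype.card G = 4)) :
    ∃ S : Finset G, #S = k ∧ ∑ g ∈ S, g = 0 := by
  set T : Finset G := {g : G | -g = g} with hTdef
  set A : Finset G := {g : G | -g ≠ g} with hAdef
  have hcard : #T + #A = Fintype.card G := by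
    simpa using Finset.card_filter_add_card_filter_not (s := univ) (fun g : G => -g = g)
  have hA : ∀ g ∈ A, -g ∈ A := by
    intro g hg
    simpa [hAdef, eq_comm] using hg
  have hne : ∀ g ∈ A, -g ≠ g := by simp [hAdef]
  have heven := even_card_of_neg_mem hA hne
  have key : ∀ U ⊆ T, ∑ g ∈ U, g = 0 → #U ≤ k → Even (k - #U) → k - #U ≤ #A →
      ∃ S : Finset G, #S = k ∧ ∑ g ∈ S, g = 0 := by
    intro U hU hsum hle hev hkA
    obtain ⟨m, hm⟩ := hev
    obtain ⟨B, hBA, -, hBcard, hBsum⟩ :=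
      exists_subset_sum_eq_zero_of_neg_mem hA hne m (by omega)
    have hdisj : Disjoint U B := by
      rw [disjoint_left]
      intro g hgU hgB
      exact hne g (hBA hgB) (by simpa [hTdef] using hU hgU)
    refine ⟨U ∪ B, ?_, ?_⟩
    · rw [card_union_of_disjoint hdisj]
      omega
    · rw [sum_union hdisj, hsum, hBsum, add_zero]
  have h0 : (0 : G) ∈ T := by simp [hTdef]
  have hpos : 0 < #T := card_pos.2 ⟨0, h0⟩
  have hklein : 3 ≤ #T → ∃ b c : G, b + b = 0 ∧ c + c = 0 ∧ b ≠ 0 ∧ c ≠ 0 ∧ b ≠ c ∧ b + c ≠ 0 ∧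
      T = {0, b, c, b + c} := by
    intro h3
    obtain ⟨b, hb, hb0⟩ := exists_mem_ne (by omega : 1 < #T) 0
    obtain ⟨c, hc, hc0b⟩ : ∃ c ∈ T, c ∉ ({0, b} : Finset G) :=
      exists_mem_notMem_of_card_lt_card (card_le_two.trans_lt (by omega))
    simp only [mem_insert, mem_singleton, not_or] at hc0b
    simp only [hTdef, mem_filter_univ, neg_eq_iff_add_eq_zero] at hb hc
    have hbc : b + c ≠ 0 := fun h => hc0b.2 (add_left_cancel (h.trans hb.symm))
    refine ⟨b, c, hb, hc, hb0, hc0b.1, Ne.symm hc0b.2, hbc, Eq.symm ?_⟩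
    refine eq_of_subset_of_card_le ?_ (hT.trans_eq ?_)
    · intro g
      simp only [mem_insert, mem_singleton, hTdef, mem_filter_univ, neg_eq_iff_add_eq_zero]
      rintro (rfl | rfl | rfl | rfl)
      · simp
      · exact hb
      · exact hc
      · rw [add_add_add_comm, hb, hc, add_zero]
    · rw [card_insert_of_notMem, card_insert_of_notMem, card_insert_of_notMem, card_singleton]
      · simpa using hb0
      · simpa using ⟨Ne.symm hc0b.2, hc0b.1⟩
      · simpa using ⟨Ne.symm hb0, Ne.symm hc0b.1, Ne.symm hbc⟩
  rcases Nat.even_or_odd k with hke | hko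
  · by_cases hkA : k ≤ #A
    · exact key ∅ (by simp) (by simp) (by simp) (by simpa using hke) (by simpa using hkA)
    have hT3 : 3 ≤ #T := by grind
    obtain ⟨b, c, hb, hc, hb0, hc0, hbc, hbc0, hTeq⟩ := hklein hT3
    have hT4 : #T = 4 := by
      rw [hTeq]
      grind
    have hsum : ∑ g ∈ T, g = 0 := by
      rw [hTeq, sum_insert (by grind), sum_insert (by grind), sum_insert (by grind), sum_singleton,
        zero_add, ← add_assoc, add_add_add_comm, hb, hc, add_zero]
    refine key T subset_rfl hsum ?_ ?_ ?_ <;> grind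
  · by_cases hkA : k ≤ #A + 1
    · refine key {0} (by simpa using h0) (by simp) ?_ ?_ ?_
      · simpa [Nat.one_le_iff_ne_zero] using hko.pos.ne'
      · simpa using Nat.Odd.sub_odd hko odd_one
      · simpa using hkA
    have hT3 : 3 ≤ #T := by grind
    obtain ⟨b, c, hb, hc, hb0, hc0, hbc, hbc0, hTeq⟩ := hklein hT3
    have hU : #({b, c, b + c} : Finset G) = 3 := by
      grind
    have hsum : ∑ g ∈ ({b, c, b + c} : Finset G), g = 0 := by
      rw [sum_insert (by grind), sum_insert (by grind), sum_singleton,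
        ← add_assoc, add_add_add_comm, hb, hc, add_zero]
    refine key {b, c, b + c} ?_ hsum ?_ ?_ ?_
    · rw [hTeq]
      exact subset_insert _ _
    all_goals grind

end SubsetSum

section Curve

open Module Finset Polynomial WeierstrassCurve.Affine WeierstrassCurve.Affine.CoordinateRing

variable (W : WeierstrassCurve F)

/-- The ideal of functions on the affine curve vanishing at a point, which is the unit ideal for
the point at infinity. -/
noncomputable def pointIdeal : W.toAffine.Point → Ideal W.toAffine.CoordinateRing
  | .zero => ⊤
  | .some x y _ => XYIdeal W.toAffine x (C y)

/-- Evaluation of functions on the affine curve at a point, which is zero by convention at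
infinity. -/
noncomputable def pointEval : W.toAffine.Point → W.toAffine.CoordinateRing →ₗ[F] F
  | .zero => 0
  | .some x y h => (quotientXYIdealEquiv (W' := W.toAffine) (x := x) (y := C y) h.1).toLinearMap ∘ₗ
      (Ideal.Quotient.mkₐ F (XYIdeal W.toAffine x (C y))).toLinearMap

variable {W}

lemma pointEval_eq_zero_iff {P : W.toAffine.Point} (hP : P ≠ 0) {f : W.toAffine.CoordinateRing} :
    pointEval W P f = 0 ↔ f ∈ pointIdeal W P := by
  cases P with
  | zero => exact absurd rfl hP
  | some x y h =>
    simp only [pointEval, pointIdeal, LinearMap.comp_apply, AlgEquiv.toLinearMap_apply,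
      AlgHom.toLinearMap_apply, EmbeddingLike.map_eq_zero_iff]
    exact Ideal.Quotient.eq_zero_iff_mem

lemma pointEval_surjective {P : W.toAffine.Point} (hP : P ≠ 0) :
    Function.Surjective (pointEval W P) := by
  cases P with
  | zero => exact absurd rfl hP
  | some x y h =>
    exact (quotientXYIdealEquiv (W' := W.toAffine) (x := x) (y := C y) h.1).surjective.comp
      Ideal.Quotient.mk_surjective

lemma isCoprime_pointIdeal {P Q : W.toAffine.Point} (hPQ : P ≠ Q) :
    IsCoprime (pointIdeal W P) (pointIdeal W Q) := by
  cases P with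
  | zero => simp [pointIdeal, Ideal.isCoprime_iff_sup_eq]
  | some x₁ y₁ h₁ =>
    cases Q with
    | zero => simp [pointIdeal, Ideal.isCoprime_iff_sup_eq]
    | some x₂ y₂ h₂ =>
      rw [Ideal.isCoprime_iff_exists]
      by_cases hx : x₁ = x₂
      · have hy : y₂ - y₁ ≠ 0 := by
          intro hy
          rw [sub_eq_zero] at hy
          subst hx hy
          exact hPQ rfl
        refine ⟨mk W.toAffine (C (C (y₂ - y₁)⁻¹)) * YClass W.toAffine (C y₁),
          Ideal.mul_mem_left _ _ (Ideal.subset_span (by simp)),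
          mk W.toAffine (C (C (-(y₂ - y₁)⁻¹))) * YClass W.toAffine (C y₂),
          Ideal.mul_mem_left _ _ (Ideal.subset_span (by simp)), ?_⟩
        rw [YClass, YClass, ← map_mul (CoordinateRing.mk _), ← map_mul (CoordinateRing.mk _), ← map_add,
          ← map_one (CoordinateRing.mk W.toAffine)]
        congr 1
        rw [← C_1, ← C_1, ← inv_mul_cancel₀ hy]
        simp only [C_mul, C_sub, C_neg]
        ring
      · have hx : x₂ - x₁ ≠ 0 := sub_ne_zero.2 (Ne.symm hx)
        refine ⟨mk W.toAffine (C (C (x₂ - x₁)⁻¹)) * XClass W.toAffine x₁,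
          Ideal.mul_mem_left _ _ (Ideal.subset_span (by simp)),
          mk W.toAffine (C (C (-(x₂ - x₁)⁻¹))) * XClass W.toAffine x₂,
          Ideal.mul_mem_left _ _ (Ideal.subset_span (by simp)), ?_⟩
        rw [XClass, XClass, ← map_mul (CoordinateRing.mk _), ← map_mul (CoordinateRing.mk _), ← map_add,
          ← map_one (CoordinateRing.mk W.toAffine)]
        congr 1
        rw [← C_1, ← C_1, ← inv_mul_cancel₀ hx]
        simp only [C_mul, C_sub, C_neg]
        ring

lemma pi_pointEval_surjective {S : Finset W.toAffine.Point} (hS : 0 ∉ S) :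
    Function.Surjective (LinearMap.pi fun P : S => pointEval W P.1) := by
  have h0 : ∀ P : S, P.1 ≠ 0 := fun P h => hS (h ▸ P.2)
  intro z
  choose r hr using fun P : S => pointEval_surjective (h0 P) (z P)
  obtain ⟨f, hf⟩ := Ideal.exists_forall_sub_mem_ideal (I := fun P : S => pointIdeal W P.1)
    (fun P Q hPQ => isCoprime_pointIdeal fun h => hPQ (Subtype.ext h)) r
  refine ⟨f, funext fun P => ?_⟩
  have := (pointEval_eq_zero_iff (h0 P)).2 (hf P)
  rw [map_sub, sub_eq_zero, hr] at this
  exact this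

lemma finiteDimensional_quotient_span_singleton {f : W.toAffine.CoordinateRing} (hf : f ≠ 0) :
    FiniteDimensional F (W.toAffine.CoordinateRing ⧸ Ideal.span {f}) :=
  Module.Finite.equiv (Ideal.quotientEquivDirectSum F (CoordinateRing.basis W.toAffine)
    (Ideal.span_singleton_eq_bot.not.2 hf)).symm

lemma exists_quotient_pointEval {f : W.toAffine.CoordinateRing} {S : Finset W.toAffine.Point}
    (hS : 0 ∉ S) (hfS : ∀ P ∈ S, pointEval W P f = 0) :
    ∃ φ : (W.toAffine.CoordinateRing ⧸ Ideal.span {f}) →ₗ[F] (S → F),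
      Function.Surjective φ ∧ ∀ g P, φ (Ideal.Quotient.mk _ g) P = pointEval W P.1 g := by
  have h0 : ∀ P ∈ S, P ≠ 0 := fun P hP h => hS (h ▸ hP)
  let ψ := ((Ideal.span {f}).restrictScalars F).liftQ
    (LinearMap.pi fun P : S => pointEval W P.1) (by
      intro g hg
      ext P
      refine (pointEval_eq_zero_iff (h0 _ P.2)).2 ?_
      refine (Ideal.span_singleton_le_iff_mem _).2 ?_ hg
      exact (pointEval_eq_zero_iff (h0 _ P.2)).1 (hfS _ P.2))
  have hψ : ∀ g P, (ψ ∘ₗ (Submodule.Quotient.restrictScalarsEquiv F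
      (Ideal.span {f})).symm.toLinearMap) (Ideal.Quotient.mk _ g) P = pointEval W P.1 g :=
    fun g P => rfl
  refine ⟨_, fun z => ?_, hψ⟩
  obtain ⟨g, rfl⟩ := pi_pointEval_surjective hS z
  exact ⟨Ideal.Quotient.mk _ g, funext fun P => hψ g P⟩

/-- A function with pole order `d` at infinity has at most `d` rational zeros. -/
lemma card_le_natDegree_norm {f : W.toAffine.CoordinateRing} (hf : f ≠ 0)
    {S : Finset W.toAffine.Point} (hS : 0 ∉ S) (hfS : ∀ P ∈ S, pointEval W P f = 0) :
    #S ≤ (Algebra.norm F[X] f).natDegree := by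
  have := finiteDimensional_quotient_span_singleton hf
  obtain ⟨φ, hφ, -⟩ := exists_quotient_pointEval hS hfS
  rw [← finrank_quotient_span_eq_natDegree_norm (CoordinateRing.basis W.toAffine) hf]
  simpa using LinearMap.finrank_le_finrank_of_surjective hφ

lemma dvd_of_natDegree_norm_le_card {f g : W.toAffine.CoordinateRing} (hf : f ≠ 0)
    {S : Finset W.toAffine.Point} (hS : 0 ∉ S) (hfS : ∀ P ∈ S, pointEval W P f = 0)
    (hle : (Algebra.norm F[X] f).natDegree ≤ #S) (hgS : ∀ P ∈ S, pointEval W P g = 0) :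
    f ∣ g := by
  have := finiteDimensional_quotient_span_singleton hf
  obtain ⟨φ, hφ, hφg⟩ := exists_quotient_pointEval hS hfS
  have heq : finrank F (W.toAffine.CoordinateRing ⧸ Ideal.span {f}) = finrank F (S → F) := by
    rw [finrank_quotient_span_eq_natDegree_norm (CoordinateRing.basis W.toAffine) hf]
    simpa using hle.antisymm (card_le_natDegree_norm hf hS hfS)
  have hinj := (LinearMap.injective_iff_surjective_of_finrank_eq_finrank heq).2 hφ
  rw [← Ideal.mem_span_singleton, ← Ideal.Quotient.eq_zero_iff_mem]
  refine hinj ?_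
  rw [map_zero]
  ext P
  rw [hφg]
  exact hgS _ P.2

/-- The affine points of a finite set with zero sum are the zeros of a function. -/
lemma exists_zeros_eq {S : Finset W.toAffine.Point} (hS : 0 ∉ S) (hsum : ∑ P ∈ S, P = 0) :
    ∃ f : W.toAffine.CoordinateRing, f ≠ 0 ∧ (∀ P ∈ S, pointEval W P f = 0) ∧
      (Algebra.norm F[X] f).natDegree ≤ #S := by
  have h0 : ∀ P ∈ S, P ≠ 0 := fun P hP h => hS (h ▸ hP)
  obtain ⟨f, hf0, hf⟩ : ∃ f : W.toAffine.CoordinateRing, f ≠ 0 ∧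
      ∏ P ∈ S, pointIdeal W P = Ideal.span {f} := by
    let U : W.toAffine.Point →
        (FractionalIdeal (nonZeroDivisors W.toAffine.CoordinateRing) W.toAffine.FunctionField)ˣ
      | .zero => 1
      | .some _ _ h => XYIdeal' (W := W.toAffine) h
    have hU : ∀ P, (U P : FractionalIdeal (nonZeroDivisors W.toAffine.CoordinateRing)
        W.toAffine.FunctionField) = (pointIdeal W P : Ideal W.toAffine.CoordinateRing) := by
      rintro (_ | ⟨x, y, h⟩)
      · exact (FractionalIdeal.coeIdeal_top _).symm
      · rfl
    have hclass : ∀ P, Point.toClass P = Additive.ofMul (ClassGroup.mk W.toAffine.FunctionField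
        (U P)) := by
      rintro (_ | ⟨x, y, h⟩)
      · exact congrArg Additive.ofMul (map_one (ClassGroup.mk W.toAffine.FunctionField)).symm
      · rfl
    have hmk : ClassGroup.mk W.toAffine.FunctionField (∏ P ∈ S, U P) = 1 := by
      have := congrArg Point.toClass hsum
      rw [map_sum, map_zero, Finset.sum_congr rfl fun P _ => hclass P, ← ofMul_prod,
        ← map_prod] at this
      exact this
    refine (ClassGroup.mk_eq_one_of_coe_ideal ?_).1 hmk
    rw [Units.coe_prod, Finset.prod_congr rfl fun P _ => hU P]
    exact (map_prod (FractionalIdeal.coeIdealHom _ _) _ _).symm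
  have hmem : ∀ g : W.toAffine.CoordinateRing,
      g ∈ Ideal.span {f} ↔ ∀ P ∈ S, pointEval W P g = 0 := by
    intro g
    rw [← hf, Ideal.prod_eq_iInf_of_pairwise_isCoprime
      fun P _ Q _ hPQ => isCoprime_pointIdeal hPQ]
    simp only [Submodule.mem_iInf]
    exact forall₂_congr fun P hP => (pointEval_eq_zero_iff (h0 P hP)).symm
  have hfS := (hmem f).1 (Ideal.mem_span_singleton_self f)
  refine ⟨f, hf0, hfS, ?_⟩
  have := finiteDimensional_quotient_span_singleton hf0
  obtain ⟨φ, -, hφ⟩ := exists_quotient_pointEval hS hfS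
  have hinj : Function.Injective φ := by
    rw [← LinearMap.ker_eq_bot, LinearMap.ker_eq_bot']
    intro g hg
    obtain ⟨g, rfl⟩ := Ideal.Quotient.mk_surjective g
    rw [Ideal.Quotient.eq_zero_iff_mem, hmem]
    intro P hP
    rw [← hφ g ⟨P, hP⟩, hg, Pi.zero_apply]
  rw [← finrank_quotient_span_eq_natDegree_norm (CoordinateRing.basis W.toAffine) hf0]
  simpa using LinearMap.finrank_le_finrank_of_injective hinj

lemma degree_norm_le_iff (p q : F[X]) (m : ℕ) :
    (Algebra.norm F[X] (p • (1 : W.toAffine.CoordinateRing) + q • mk W.toAffine X)).degree ≤ m ↔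
      p ∈ degreeLT F (m / 2 + 1) ∧ q ∈ degreeLT F ((m - 1) / 2) := by
  rw [degree_norm_smul_basis, max_le_iff, mem_degreeLT, mem_degreeLT]
  refine and_congr ?_ ?_
  · rcases eq_or_ne p 0 with rfl | hp
    · simp
    · rw [degree_eq_natDegree hp, two_nsmul]
      norm_cast
      omega
  · rcases eq_or_ne q 0 with rfl | hq
    · simp
    · rw [degree_eq_natDegree hq, two_nsmul]
      norm_cast
      omega

variable (F) in
/-- Coefficients of the functions with a pole of order at most `k` at infinity. -/
abbrev PoleSpace (k : ℕ) : Type := degreeLT F (k / 2 + 1) × degreeLT F ((k - 1) / 2)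

lemma finrank_poleSpace {k : ℕ} (hk : 1 ≤ k) : finrank F (PoleSpace F k) = k := by
  rw [finrank_prod, (degreeLTEquiv F _).finrank_eq, (degreeLTEquiv F _).finrank_eq]
  simp only [finrank_fin_fun]
  omega

instance (k : ℕ) : FiniteDimensional F (PoleSpace F k) :=
  have (m : ℕ) : FiniteDimensional F (degreeLT F m) := (degreeLTEquiv F m).symm.finiteDimensional
  inferInstance

variable (W) in
/-- The function `p(X) + q(X) Y` with given coefficients `p` and `q`. -/
noncomputable def toCoordinateRing (k : ℕ) : PoleSpace F k →ₗ[F] W.toAffine.CoordinateRing where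
  toFun v := (v.1 : F[X]) • 1 + (v.2 : F[X]) • CoordinateRing.mk W.toAffine X
  map_add' v w := by
    simp only [Prod.fst_add, Prod.snd_add, Submodule.coe_add, add_smul]
    abel
  map_smul' c v := by
    simp only [Prod.smul_fst, Prod.smul_snd, SetLike.val_smul, smul_add, smul_assoc,
      RingHom.id_apply]

lemma toCoordinateRing_injective (k : ℕ) : Function.Injective (toCoordinateRing W k) := by
  rw [← LinearMap.ker_eq_bot, LinearMap.ker_eq_bot']
  intro v hv
  obtain ⟨h1, h2⟩ := smul_basis_eq_zero hv
  exact Prod.ext (Subtype.ext h1) (Subtype.ext h2)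

lemma exists_toCoordinateRing_eq_iff {k : ℕ} {f : W.toAffine.CoordinateRing} :
    (∃ v, toCoordinateRing W k v = f) ↔ (Algebra.norm F[X] f).degree ≤ k := by
  constructor
  · rintro ⟨v, rfl⟩
    exact (degree_norm_le_iff _ _ k).2 ⟨v.1.2, v.2.2⟩
  · intro h
    obtain ⟨p, q, rfl⟩ := exists_smul_basis_eq f
    obtain ⟨hp, hq⟩ := (degree_norm_le_iff _ _ k).1 h
    exact ⟨⟨⟨p, hp⟩, ⟨q, hq⟩⟩, rfl⟩

variable (F) in
/-- The leading coefficient at infinity of a function with a pole of order at most `k`. -/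
noncomputable def leadCoeff (k : ℕ) : PoleSpace F k →ₗ[F] F :=
  if Even k then lcoeff F (k / 2) ∘ₗ Submodule.subtype _ ∘ₗ LinearMap.fst F _ _
  else lcoeff F ((k - 3) / 2) ∘ₗ Submodule.subtype _ ∘ₗ LinearMap.snd F _ _

lemma mem_degreeLT_of_coeff_eq_zero {m : ℕ} {p : F[X]} (hp : p ∈ degreeLT F (m + 1))
    (h : p.coeff m = 0) : p ∈ degreeLT F m := by
  rw [mem_degreeLT, degree_lt_iff_coeff_zero] at *
  intro i hi
  rcases hi.eq_or_lt with rfl | hi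
  exacts [h, hp i hi]

lemma leadCoeff_eq_zero_iff {k : ℕ} (hk : 2 ≤ k) (v : PoleSpace F k) :
    leadCoeff F k v = 0 ↔
      (Algebra.norm F[X] (toCoordinateRing W k v)).degree ≤ (k - 1 : ℕ) := by
  have hv := degree_norm_le_iff (W := W) v.1.1 v.2.1 (k - 1)
  refine Iff.trans ?_ hv.symm
  obtain ⟨⟨p, hp⟩, ⟨q, hq⟩⟩ := v
  by_cases hev : Even k
  · have h1 : (k - 1) / 2 + 1 = k / 2 := by grind
    have h2 : (k - 1 - 1) / 2 = (k - 1) / 2 := by grind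
    simp only [leadCoeff, hev, if_true, h1, h2, hq, and_true, LinearMap.comp_apply,
      LinearMap.fst_apply, Submodule.subtype_apply, lcoeff_apply]
    exact ⟨mem_degreeLT_of_coeff_eq_zero hp,
      fun h => coeff_eq_zero_of_degree_lt (mem_degreeLT.1 h)⟩
  · have h1 : (k - 1) / 2 + 1 = k / 2 + 1 := by grind
    have h2 : (k - 1 - 1) / 2 = (k - 3) / 2 := by grind
    have h3 : (k - 1) / 2 = (k - 3) / 2 + 1 := by grind
    simp only [leadCoeff, hev, if_false, h1, h2, hp, true_and, LinearMap.comp_apply,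
      LinearMap.snd_apply, Submodule.subtype_apply, lcoeff_apply]
    exact ⟨mem_degreeLT_of_coeff_eq_zero (h3 ▸ hq),
      fun h => coeff_eq_zero_of_degree_lt (mem_degreeLT.1 h)⟩

lemma exists_eq_algebraMap_of_natDegree_norm_le_one {f : W.toAffine.CoordinateRing}
    (hf : (Algebra.norm F[X] f).natDegree ≤ 1) : ∃ c : F, f = algebraMap F _ c := by
  have h0 : (Algebra.norm F[X] f).degree ≤ (0 : ℕ) := by
    have := CoordinateRing.natDegree_norm_ne_one f
    exact degree_le_of_natDegree_le (by omega)
  obtain ⟨p, q, rfl⟩ := exists_smul_basis_eq f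
  obtain ⟨hp, hq⟩ := (degree_norm_le_iff _ _ 0).1 h0
  have hq0 : q = 0 := by simpa [mem_degreeLT] using hq
  have hp0 : p = C (p.coeff 0) := by
    refine eq_C_of_degree_le_zero ?_
    rw [mem_degreeLT] at hp
    exact Order.le_of_lt_succ hp
  refine ⟨p.coeff 0, ?_⟩
  rw [hq0, zero_smul, add_zero, hp0, coeff_C_zero, ← algebraMap_eq, algebraMap_smul,
    Algebra.algebraMap_eq_smul_one]

lemma exists_smul_eq_of_natDegree_norm_le_card {f g : W.toAffine.CoordinateRing} (hf : f ≠ 0)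
    {S : Finset W.toAffine.Point} (hS : 0 ∉ S) (hfS : ∀ P ∈ S, pointEval W P f = 0)
    (hgS : ∀ P ∈ S, pointEval W P g = 0) (hle : (Algebra.norm F[X] f).natDegree ≤ #S)
    (hg : (Algebra.norm F[X] g).natDegree ≤ #S + 1) : ∃ c : F, c • f = g := by
  obtain ⟨h, rfl⟩ := dvd_of_natDegree_norm_le_card hf hS hfS hle hgS
  rcases eq_or_ne h 0 with rfl | hh
  · exact ⟨0, by simp⟩
  have hcard := card_le_natDegree_norm hf hS hfS
  have hne : ∀ x : W.toAffine.CoordinateRing, x ≠ 0 → Algebra.norm F[X] x ≠ 0 := fun x hx =>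
    (Algebra.norm_ne_zero_iff_of_basis (CoordinateRing.basis W.toAffine)).2 hx
  rw [map_mul, natDegree_mul (hne f hf) (hne h hh)] at hg
  obtain ⟨c, rfl⟩ := exists_eq_algebraMap_of_natDegree_norm_le_one (f := h) (by omega)
  exact ⟨c, by rw [Algebra.smul_def, mul_comm]⟩

/-- Functions with poles of order at most `#S + 1` at infinity and vanishing on a common set `S`
of affine points are proportional. -/
lemma exists_smul_eq {f g : W.toAffine.CoordinateRing} (hf : f ≠ 0)
    {S : Finset W.toAffine.Point} (hS : 0 ∉ S) (hfS : ∀ P ∈ S, pointEval W P f = 0)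
    (hgS : ∀ P ∈ S, pointEval W P g = 0) (hfd : (Algebra.norm F[X] f).degree ≤ (#S + 1 : ℕ))
    (hgd : (Algebra.norm F[X] g).degree ≤ (#S + 1 : ℕ)) : ∃ c : F, c • f = g := by
  rcases Nat.lt_or_ge #S ((Algebra.norm F[X] f).natDegree) with hlt | hle
  swap
  · exact exists_smul_eq_of_natDegree_norm_le_card hf hS hfS hgS hle (natDegree_le_of_degree_le hgd)
  have hS1 : 1 ≤ #S := by
    have := CoordinateRing.natDegree_norm_ne_one f
    have := natDegree_le_of_degree_le hfd
    omega
  obtain ⟨v, rfl⟩ := exists_toCoordinateRing_eq_iff.2 hfd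
  obtain ⟨w, rfl⟩ := exists_toCoordinateRing_eq_iff.2 hgd
  have hlead : leadCoeff F (#S + 1) v ≠ 0 := by
    rw [Ne, leadCoeff_eq_zero_iff (W := W) (by omega)]
    intro h
    exact absurd (natDegree_le_of_degree_le h) (by simpa using hlt)
  let u := w - (leadCoeff F (#S + 1) w / leadCoeff F (#S + 1) v) • v
  have hu : leadCoeff F (#S + 1) u = 0 := by simp [u, hlead]
  rw [leadCoeff_eq_zero_iff (W := W) (by omega)] at hu
  rcases eq_or_ne u 0 with hu0 | hu0
  · exact ⟨_, by rw [← map_smul, ← sub_eq_zero.1 hu0]⟩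
  · obtain ⟨c, hc⟩ := exists_smul_eq_of_natDegree_norm_le_card
      (f := toCoordinateRing W _ u) (g := toCoordinateRing W _ v)
      ((map_ne_zero_iff _ (toCoordinateRing_injective _)).2 hu0) hS
      (fun P hP => by simp [u, hfS P hP, hgS P hP]) hfS (natDegree_le_of_degree_le hu)
      (natDegree_le_of_degree_le hfd)
    rw [← map_smul] at hc
    have hc' := congrArg (leadCoeff F (#S + 1)) (toCoordinateRing_injective _ hc)
    rw [map_smul, (leadCoeff_eq_zero_iff (W := W) (by omega) u).2 hu,
      smul_zero] at hc'
    exact absurd hc'.symm hlead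

variable (W) in
/-- Evaluation at a rational point of a function with a pole of order at most `k` at infinity,
which at infinity is the leading coefficient. -/
noncomputable def poleEval (k : ℕ) (P : W.toAffine.Point) : PoleSpace F k →ₗ[F] F :=
  if P = 0 then leadCoeff F k else pointEval W P ∘ₗ toCoordinateRing W k

/-- Vanishing on a set of rational points, in terms of its affine points and the pole order. -/
lemma exists_poleEval_eq_zero_iff {k : ℕ} (hk : 2 ≤ k) (S : Finset W.toAffine.Point) :
    ∃ m ≤ k, #S + m = #(S.erase 0) + k ∧ ∀ v, (∀ P ∈ S, poleEval W k P v = 0) ↔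
      (Algebra.norm F[X] (toCoordinateRing W k v)).degree ≤ m ∧
        ∀ P ∈ S.erase 0, pointEval W P (toCoordinateRing W k v) = 0 := by
  by_cases h0 : 0 ∈ S
  · refine ⟨k - 1, by omega, ?_, fun v => ?_⟩
    · have := card_erase_add_one h0
      omega
    · rw [← leadCoeff_eq_zero_iff hk]
      constructor
      · intro h
        refine ⟨by simpa [poleEval] using h 0 h0, fun P hP => ?_⟩
        simpa [poleEval, ne_of_mem_erase hP] using h P (mem_of_mem_erase hP)
      · rintro ⟨h, h'⟩ P hP
        rcases eq_or_ne P 0 with rfl | hP0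
        · simpa [poleEval] using h
        · simpa [poleEval, hP0] using h' P (mem_erase.2 ⟨hP0, hP⟩)
  · refine ⟨k, le_rfl, by rw [erase_eq_of_notMem h0], fun v => ?_⟩
    rw [erase_eq_of_notMem h0, and_iff_right (exists_toCoordinateRing_eq_iff.1 ⟨v, rfl⟩)]
    refine forall₂_congr fun P hP => ?_
    rw [poleEval, if_neg (ne_of_mem_of_not_mem hP h0), LinearMap.comp_apply]

lemma card_neg_eq_self_le [Fintype W.toAffine.Point] [W.IsElliptic] :
    #{P : W.toAffine.Point | -P = P} ≤ 4 := by
  set S : Finset W.toAffine.Point := {P : W.toAffine.Point | -P = P}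
  let f : W.toAffine.CoordinateRing :=
    (C W.a₁ * X + C W.a₃ : F[X]) • 1 + (C 2 : F[X]) • CoordinateRing.mk W.toAffine X
  have hf : f ≠ 0 := by
    intro hf
    obtain ⟨h1, h2⟩ := smul_basis_eq_zero hf
    have ha₁ : W.a₁ = 0 := by simpa using congrArg (coeff · 1) h1
    have ha₃ : W.a₃ = 0 := by simpa using congrArg (coeff · 0) h1
    have h2 : (2 : F) = 0 := by simpa using congrArg (coeff · 0) h2
    refine W.isUnit_Δ.ne_zero ?_
    have h4 : (4 : F) = 0 := by linear_combination 2 * h2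
    simp [WeierstrassCurve.Δ, WeierstrassCurve.b₂, WeierstrassCurve.b₄, WeierstrassCurve.b₆,
      ha₁, ha₃, h2, h4]
  have hdeg : (Algebra.norm F[X] f).natDegree ≤ 3 := by
    refine natDegree_le_of_degree_le ((degree_norm_le_iff _ _ 3).2 ⟨?_, ?_⟩)
    · rw [mem_degreeLT]
      exact degree_linear_le.trans_lt (by norm_num)
    · rw [mem_degreeLT]
      exact degree_C_le.trans_lt (by norm_num)
  have hcard := card_le_natDegree_norm hf (S := S.erase 0) (by simp) (by
    intro P hP
    obtain ⟨hP0, hP⟩ := mem_erase.1 hP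
    rw [pointEval_eq_zero_iff hP0]
    rcases P with _ | ⟨x, y, h⟩
    · exact absurd rfl hP0
    have hy : W.toAffine.negY x y = y := by simpa [S] using hP
    have heq : f = CoordinateRing.mk W.toAffine (C (C W.a₁)) * XClass W.toAffine x +
        CoordinateRing.mk W.toAffine (C (C 2)) * YClass W.toAffine (C y) := by
      have ha₃ : W.a₃ = -(2 * y) - W.a₁ * x := by
        rw [negY] at hy
        linear_combination -hy
      simp only [f, CoordinateRing.smul, XClass, YClass, ha₃, ← map_mul, ← map_add, mul_one]
      refine congrArg (CoordinateRing.mk W.toAffine) ?_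
      simp only [C_mul, C_sub, C_neg, C_add]
      ring
    rw [heq]
    exact add_mem (Ideal.mul_mem_left _ _ (Ideal.subset_span (by simp)))
      (Ideal.mul_mem_left _ _ (Ideal.subset_span (by simp))))
  have := pred_card_le_card_erase (s := S) (a := 0)
  omega

end Curve

lemma exists_isNMDS_of_four_two : ∃ C : Submodule F (Fin 4 → F),
    Module.finrank F C = 2 ∧ minDist C = 4 - 2 ∧ IsNMDS C := by
  refine ⟨_, isNMDS_range (LinearMap.funLeft F F (![0, 0, 1, 1] : Fin 4 → Fin 2)) (by simp)
    (by norm_num) (by norm_num) ?_ ?_ ⟨![0, 1], by simp, ?_⟩⟩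
  · intro v hv
    have hv : v 0 ≠ 0 ∨ v 1 ≠ 0 := by
      by_contra! h
      exact hv (funext fun i => by fin_cases i <;> simp [h])
    rcases hv with hv | hv
    · refine (Finset.card_le_card (t := {2, 3}) fun i hi => ?_).trans (by simp)
      replace hi := (Finset.mem_filter.1 hi).2
      fin_cases i <;> simp_all [LinearMap.funLeft_apply]
    · refine (Finset.card_le_card (t := {0, 1}) fun i hi => ?_).trans (by simp)
      replace hi := (Finset.mem_filter.1 hi).2
      fin_cases i <;> simp_all [LinearMap.funLeft_apply]
  · intro S hS v w hv hvS hwS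
    obtain ⟨i, rfl⟩ := Finset.card_eq_one.1 (Nat.succ_injective hS)
    simp only [Finset.mem_singleton, forall_eq, LinearMap.funLeft_apply] at hvS hwS
    generalize (![0, 0, 1, 1] : Fin 4 → Fin 2) i = a at hvS hwS
    have hne : ∀ b, b ≠ a → v b ≠ 0 := by
      intro b hb hvb
      refine hv (funext fun c => ?_)
      obtain rfl | rfl : c = a ∨ c = b := by omega
      exacts [hvS, hvb]
    refine ⟨w (1 - a) / v (1 - a), funext fun b => ?_⟩
    rcases eq_or_ne b a with rfl | hb
    · simp [hvS, hwS]
    · obtain rfl : b = 1 - a := by omega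
      simp [hne _ hb]
  · refine (Finset.card_le_card (s := {0, 1}) fun i hi => Finset.mem_filter.2 ⟨Finset.mem_univ _, ?_⟩).trans'
      (by simp)
    fin_cases i <;> simp_all [LinearMap.funLeft_apply]

/-- (Theorem 1.1) Let `E/F_q` be an elliptic curve with exactly `n`
`F_q`-rational points. Then for every `k = 2, 3, …, n - 1` there exists a near-MDS linear
`[n, k, n - k]_q` code over `F_q`. -/
theorem statement19 (W : WeierstrassCurve F) [W.IsElliptic] {n : ℕ}
    (hn : n = Nat.card W.toAffine.Point)
    {k : ℕ} (hk2 : 2 ≤ k) (hkn : k ≤ n - 1) :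
    ∃ C : Submodule F (Fin n → F),
      Module.finrank F C = k ∧ minDist C = n - k ∧ IsNMDS C := by
  by_cases hex : k = 2 ∧ n = 4
  · obtain ⟨rfl, rfl⟩ := hex
    exact exists_isNMDS_of_four_two
  have : Finite W.toAffine.Point := Nat.finite_of_card_ne_zero (by omega)
  have := Fintype.ofFinite W.toAffine.Point
  rw [Nat.card_eq_fintype_card] at hn
  let e : Fin n ≃ W.toAffine.Point := (Fintype.equivFinOfCardEq hn.symm).symm
  have hzero (S : Finset W.toAffine.Point) (h : 0 ∈ S.erase 0) : False := by simp at h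
  refine ⟨_, isNMDS_range (LinearMap.pi fun i => poleEval W k (e i)) (finrank_poleSpace (by omega))
    (by omega) (by omega) ?_ ?_ ?_⟩
  · intro v hv
    set S := Finset.filter (fun i => LinearMap.pi (fun i => poleEval W k (e i)) v i = 0) Finset.univ
    obtain ⟨m, hmk, hm, hiff⟩ := exists_poleEval_eq_zero_iff (W := W) hk2 (S.map e.toEmbedding)
    obtain ⟨hdeg, hvS⟩ := (hiff v).1 (by
      intro P hP
      obtain ⟨i, hi, rfl⟩ := Finset.mem_map.1 hP
      simpa using (Finset.mem_filter.1 hi).2)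
    have := card_le_natDegree_norm
      ((map_ne_zero_iff _ (toCoordinateRing_injective k)).2 hv) (hzero _) hvS
    have := Polynomial.natDegree_le_of_degree_le hdeg
    rw [Finset.card_map] at hm
    omega
  · intro S hS v w hv hvS hwS
    obtain ⟨m, hmk, hm, hiff⟩ := exists_poleEval_eq_zero_iff (W := W) hk2 (S.map e.toEmbedding)
    obtain ⟨hvd, hvS⟩ := (hiff v).1 (Finset.forall_mem_map.2 hvS)
    obtain ⟨hwd, hwS⟩ := (hiff w).1 (Finset.forall_mem_map.2 hwS)
    rw [Finset.card_map] at hm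
    obtain rfl : m = ((S.map e.toEmbedding).erase 0).card + 1 := by omega
    obtain ⟨c, hc⟩ := exists_smul_eq ((map_ne_zero_iff _ (toCoordinateRing_injective k)).2 hv)
      (hzero _) hvS hwS hvd hwd
    exact ⟨c, toCoordinateRing_injective k (by rw [map_smul, hc])⟩
  · obtain ⟨S, hS, hsum⟩ := exists_card_eq_sum_eq_zero (G := W.toAffine.Point) (k := k)
      card_neg_eq_self_le (by omega) (by omega)
    obtain ⟨m, hmk, hm, hiff⟩ := exists_poleEval_eq_zero_iff (W := W) hk2 S
    obtain ⟨f, hf, hfS, hfd⟩ := exists_zeros_eq (hzero S) ((Finset.sum_erase S rfl).trans hsum)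
    have hfm : (Algebra.norm (Polynomial F) f).degree ≤ m :=
      Polynomial.degree_le_of_natDegree_le (by omega)
    obtain ⟨v, rfl⟩ := exists_toCoordinateRing_eq_iff.2 (hfm.trans (Nat.cast_le.2 hmk))
    refine ⟨v, (map_ne_zero_iff _ (toCoordinateRing_injective k)).1 hf, ?_⟩
    refine hS.ge.trans ?_
    rw [← Finset.card_map e.symm.toEmbedding]
    refine Finset.card_le_card fun i hi => ?_
    obtain ⟨P, hP, rfl⟩ := Finset.mem_map.1 hi
    refine Finset.mem_filter.2 ⟨Finset.mem_univ _, ?_⟩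
    simpa using (hiff v).2 ⟨hfm, hfS⟩ P hP

end NMDS
end
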